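/- Mergelyan-type approximation on sets of class 𝔯(ℍ): let T ∈ 𝔯(ℍ) be bounded and such that T ∩ ℂ_I is a Jordan region in the plane ℂ_I for every unit imaginary quaternion I. If f is slice regular in T and continuous on the closure T̄, then for every ε > 0 there exists a polynomial P(q) = ∑_{k=0}^n q^k a_k with sup_{q ∈ T̄} ‖f(q) − P(q)‖ < ε. -/

import Mathlib

noncomputable section

/-- The complex plane `ℂ_I = {x + I y : x, y ∈ ℝ}` inside the quaternions, for a
unit imaginary quaternion `I`. -/
def slicePlane (I : Quaternion ℝ) : Set (Quaternion ℝ) :=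
  {q | ∃ x y : ℝ, q = (x : Quaternion ℝ) + y • I}

/-- A set `U ⊆ ℍ` is axially symmetric if `x + I y ∈ U` implies `x + J y ∈ U`
for all unit imaginary quaternions `J`. -/
def AxiallySymmetric (U : Set (Quaternion ℝ)) : Prop :=
  ∀ (x y : ℝ) (I J : Quaternion ℝ), I ^ 2 = -1 → J ^ 2 = -1 →
    ((x : Quaternion ℝ) + y • I) ∈ U → ((x : Quaternion ℝ) + y • J) ∈ U

/-- `f` is slice regular on `U`: it is real differentiable on `U` and for every unit
imaginary quaternion `I` its restriction to `U ∩ ℂ_I` satisfies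
`(1/2)(∂/∂x + I ∂/∂y) f(x + I y) = 0`. -/
def SliceRegularOn (f : Quaternion ℝ → Quaternion ℝ) (U : Set (Quaternion ℝ)) : Prop :=
  DifferentiableOn ℝ f U ∧
  ∀ (I : Quaternion ℝ), I ^ 2 = -1 → ∀ x y : ℝ, ((x : Quaternion ℝ) + y • I) ∈ U →
    fderiv ℝ (fun p : ℝ × ℝ => f ((p.1 : Quaternion ℝ) + p.2 • I)) (x, y) (1, 0)
      + I * fderiv ℝ (fun p : ℝ × ℝ => f ((p.1 : Quaternion ℝ) + p.2 • I)) (x, y) (0, 1) = 0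

/-- The slice derivative of `f` at `q`, i.e. `(∂/∂x) f`. -/
def sliceDeriv (f : Quaternion ℝ → Quaternion ℝ) (q : Quaternion ℝ) : Quaternion ℝ :=
  fderiv ℝ f q 1

/-- A quaternion is a (strictly) positive real number. -/
def IsPosReal (q : Quaternion ℝ) : Prop := ∃ r : ℝ, 0 < r ∧ q = (r : Quaternion ℝ)

/-- `f ∈ 𝒩(U)`: `f` is slice regular on `U` and preserves every slice `ℂ_I`. -/
def QIntrinsicOn (f : Quaternion ℝ → Quaternion ℝ) (U : Set (Quaternion ℝ)) : Prop :=
  SliceRegularOn f U ∧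
  ∀ (I : Quaternion ℝ), I ^ 2 = -1 → ∀ q ∈ U ∩ slicePlane I, f q ∈ slicePlane I

/-- The class `𝔯(ℍ)` of axially symmetric open sets whose intersection with every
slice plane `ℂ_I` is simply connected. -/
def MemFrakR (Ω : Set (Quaternion ℝ)) : Prop :=
  IsOpen Ω ∧ AxiallySymmetric Ω ∧
  ∀ I : Quaternion ℝ, I ^ 2 = -1 → SimplyConnectedSpace ↥(Ω ∩ slicePlane I)

/-- `S` is a Jordan region in the plane `ℂ_I`: a bounded subset of `ℂ_I`, open in `ℂ_I`,
whose boundary (inside `ℂ_I`) is a Jordan curve. -/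
def IsJordanRegionIn (I : Quaternion ℝ) (S : Set (Quaternion ℝ)) : Prop :=
  S ⊆ slicePlane I ∧ Bornology.IsBounded S ∧
  IsOpen (Subtype.val ⁻¹' S : Set ↥(slicePlane I)) ∧
  ∃ γ : Circle → ↥(slicePlane I), Continuous γ ∧ Function.Injective γ ∧
    Set.range γ = frontier (Subtype.val ⁻¹' S : Set ↥(slicePlane I))

/-- The axially symmetric completion `⋃_{x+Jy ∈ Ω, I ∈ 𝕊} {x + I y}` of a subset `Ω`
of the slice plane `ℂ_J`. -/
def axSymmCompletion (J : Quaternion ℝ) (Ω : Set (Quaternion ℝ)) : Set (Quaternion ℝ) :=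
  {q | ∃ x y : ℝ, ∃ I : Quaternion ℝ, I ^ 2 = -1 ∧
    ((x : Quaternion ℝ) + y • J) ∈ Ω ∧ q = (x : Quaternion ℝ) + y • I}

/-- The first modulus of continuity `ω₁(f; δ)` of `f` on the set `K`. -/
def omega1 (f : Quaternion ℝ → Quaternion ℝ) (K : Set (Quaternion ℝ)) (δ : ℝ) : ℝ :=
  sSup {r : ℝ | ∃ u ∈ K, ∃ v ∈ K, ‖u - v‖ ≤ δ ∧ r = ‖f u - f v‖}

open Set Filter Topology MeasureTheory

/-- `g` agrees on `K` with a uniform limit of polynomials. -/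
def IsPolyLimit (K : Set ℂ) [CompactSpace K] (g : ℂ → ℂ) : Prop :=
  ∃ h ∈ (polynomialFunctions K).topologicalClosure, ∀ z : K, h z = g z

namespace IsPolyLimit

variable {K : Set ℂ} [CompactSpace K] {g₁ g₂ : ℂ → ℂ}

theorem add (h₁ : IsPolyLimit K g₁) (h₂ : IsPolyLimit K g₂) :
    IsPolyLimit K fun z => g₁ z + g₂ z := by
  obtain ⟨a, ha, ha'⟩ := h₁
  obtain ⟨b, hb, hb'⟩ := h₂
  exact ⟨a + b, add_mem ha hb, fun z => by simp [ha', hb']⟩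

theorem mul (h₁ : IsPolyLimit K g₁) (h₂ : IsPolyLimit K g₂) :
    IsPolyLimit K fun z => g₁ z * g₂ z := by
  obtain ⟨a, ha, ha'⟩ := h₁
  obtain ⟨b, hb, hb'⟩ := h₂
  exact ⟨a * b, mul_mem ha hb, fun z => by simp [ha', hb']⟩

theorem const (K : Set ℂ) [CompactSpace K] (c : ℂ) : IsPolyLimit K fun _ => c :=
  ⟨algebraMap ℂ C(K, ℂ) c, algebraMap_mem _ c, fun z => by simp⟩

theorem id (K : Set ℂ) [CompactSpace K] : IsPolyLimit K fun z => z :=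
  ⟨Polynomial.toContinuousMapOnAlgHom K Polynomial.X,
    Subalgebra.le_topologicalClosure _ ⟨Polynomial.X, by simp⟩, fun z => by simp⟩

theorem sub (h₁ : IsPolyLimit K g₁) (h₂ : IsPolyLimit K g₂) :
    IsPolyLimit K fun z => g₁ z - g₂ z := by
  obtain ⟨a, ha, ha'⟩ := h₁
  obtain ⟨b, hb, hb'⟩ := h₂
  exact ⟨a - b, sub_mem ha hb, fun z => by simp [ha', hb']⟩

theorem sum {ι : Type*} (s : Finset ι) {g : ι → ℂ → ℂ} (h : ∀ i ∈ s, IsPolyLimit K (g i)) :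
    IsPolyLimit K fun z => ∑ i ∈ s, g i z := by
  classical
  induction s using Finset.induction_on with
  | empty => simpa using const K 0
  | insert i s hi ih =>
    simp only [Finset.sum_insert hi]
    exact (h i (by simp)).add (ih fun j hj => h j (by simp [hj]))

theorem exists_polynomial (h₁ : IsPolyLimit K g₁) {ε : ℝ} (hε : 0 < ε) :
    ∃ p : Polynomial ℂ, ∀ z ∈ K, ‖g₁ z - p.eval z‖ < ε := by
  obtain ⟨a, ha, ha'⟩ := h₁
  obtain ⟨b, hb, hab⟩ := Metric.mem_closure_iff.mp
    (show a ∈ closure ((polynomialFunctions K : Set C(K, ℂ))) from ha) ε hε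
  obtain ⟨p, -, rfl⟩ := hb
  refine ⟨p, fun z hz => ?_⟩
  have := (ContinuousMap.dist_apply_le_dist (⟨z, hz⟩ : K)).trans_lt hab
  rw [dist_eq_norm, ha'] at this
  simpa using this

theorem inv_sub (hKc : IsPreconnected Kᶜ) {a : ℂ} (ha : a ∉ K) :
    IsPolyLimit K fun z => (z - a)⁻¹ := by
  let S := (polynomialFunctions K).topologicalClosure
  have hS : IsClosed (S : Set C(K, ℂ)) := (polynomialFunctions K).isClosed_topologicalClosure
  let X : C(K, ℂ) := Polynomial.toContinuousMapOnAlgHom K Polynomial.X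
  have hX : X ∈ S := Subalgebra.le_topologicalClosure _ ⟨Polynomial.X, by simp, rfl⟩
  have hr : spectrum ℂ X = K := by
    rw [ContinuousMap.spectrum_eq_range]
    ext z
    simp [X]
  have hsp := Subalgebra.spectrum_eq_of_isPreconnected_compl (𝕜 := ℂ) S ⟨X, hX⟩
    (by simpa [hr] using hKc)
  have hu : a ∉ spectrum ℂ (⟨X, hX⟩ : S) := by
    rw [hsp]
    simpa [hr] using ha
  rw [spectrum.notMem_iff] at hu
  obtain ⟨u, hu⟩ := hu
  refine ⟨((-(↑u⁻¹ : S) : S) : C(K, ℂ)), Subtype.mem _, fun z => ?_⟩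
  have h1 : ((u : S) : C(K, ℂ)) * ((↑u⁻¹ : S) : C(K, ℂ)) = 1 := by
    rw [← MulMemClass.coe_mul, u.mul_inv]
    rfl
  have h2 := DFunLike.congr_fun h1 z
  rw [hu] at h2
  have h3 : (a - z) * ((↑u⁻¹ : S) : C(K, ℂ)) z = 1 := by simpa [X] using h2
  have h4 : (z : ℂ) - a ≠ 0 := fun h => ha (by rw [← sub_eq_zero.mp h]; exact z.2)
  refine eq_inv_of_mul_eq_one_left ?_
  have : ((-(↑u⁻¹ : S) : S) : C(K, ℂ)) z = - ((↑u⁻¹ : S) : C(K, ℂ)) z := rfl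
  rw [this]
  linear_combination h3

theorem comp_differentiableOn {φ : ℂ → ℂ}
    (hφ : DifferentiableOn ℂ φ (Metric.ball 0 1)) (h₁ : IsPolyLimit K g₁)
    (hb : ∀ z ∈ K, ‖g₁ z‖ ≤ 1 / 2) : IsPolyLimit K fun z => φ (g₁ z) := by
  obtain ⟨h, hh, hg⟩ := h₁
  have hhb : ∀ z : K, h z ∈ Metric.ball (0 : ℂ) 1 := fun z => by
    rw [mem_ball_zero_iff, hg]; linarith [hb z z.2]
  have hc : Continuous fun z : K => φ (h z) :=
    hφ.continuousOn.comp_continuous h.continuous hhb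
  refine ⟨⟨_, hc⟩, ?_, fun z => by simp [hg]⟩
  have hφ' : DifferentiableOn ℂ φ (Metric.ball 0 ((1 : NNReal) : ℝ)) := by simpa using hφ
  have hc34 : DifferentiableOn ℂ φ (Metric.closedBall 0 ((3 / 4 : NNReal) : ℝ)) :=
    hφ.mono fun z hz => by
      rw [mem_closedBall_zero_iff] at hz
      rw [mem_ball_zero_iff]
      refine hz.trans_lt ?_
      norm_num
  have hp := hc34.hasFPowerSeriesOnBall (by positivity)
  set p := cauchyPowerSeries φ 0 ((3 / 4 : NNReal) : ℝ)
  have hu := hp.tendstoUniformlyOn' (r' := 5 / 8)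
    (by rw [ENNReal.coe_lt_coe, ← NNReal.coe_lt_coe]; norm_num)
  have hmem : ∀ n, (∑ k ∈ Finset.range n, p.coeff k • h ^ k) ∈
      (polynomialFunctions K).topologicalClosure := fun n =>
    sum_mem fun k _ => Subalgebra.smul_mem _ (pow_mem hh k) _
  refine (polynomialFunctions K).isClosed_topologicalClosure.mem_of_tendsto
    (b := atTop) (f := fun n => ∑ k ∈ Finset.range n, p.coeff k • h ^ k) ?_
    (Eventually.of_forall hmem)
  rw [ContinuousMap.tendsto_iff_tendstoUniformly]
  rw [Metric.tendstoUniformlyOn_iff] at hu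
  rw [Metric.tendstoUniformly_iff]
  intro ε hε
  filter_upwards [hu ε hε] with n hn z
  have := hn (h z) (by
    rw [mem_ball_zero_iff, hg]
    refine (hb z z.2).trans_lt ?_
    norm_num)
  convert! this using 2
  simp [FormalMultilinearSeries.partialSum, mul_comm]

end IsPolyLimit

theorem Complex.re_one_sub_pos {t : ℂ} (ht : ‖t‖ < 1) : 0 < (1 - t).re := by
  have := (Complex.abs_re_le_norm t).trans_lt ht
  rw [abs_lt] at this
  simp only [Complex.sub_re, Complex.one_re]
  linarith

theorem Complex.exp_half_log_sq {w : ℂ} (hw : w ≠ 0) :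
    Complex.exp (Complex.log w / 2) ^ 2 = w := by
  rw [← Complex.exp_nat_mul]
  push_cast
  rw [mul_div_cancel₀ _ two_ne_zero, Complex.exp_log hw]

theorem Complex.log_add_log_of_re_pos {a b : ℂ} (ha : 0 < a.re) (hb : 0 < (a * b).re) :
    Complex.log a + Complex.log b = Complex.log (a * b) := by
  have ha0 : a ≠ 0 := fun h => by simp [h] at ha
  have hb0 : b ≠ 0 := fun h => by simp [h] at hb
  have hab0 : a * b ≠ 0 := mul_ne_zero ha0 hb0
  have h1 := Complex.abs_arg_lt_pi_div_two_iff.mpr (Or.inl ha)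
  have h2 := Complex.abs_arg_lt_pi_div_two_iff.mpr (Or.inl hb)
  rw [abs_lt] at h1 h2
  have h3 : Complex.log (a * b / a) = Complex.log (a * b) - Complex.log a := by
    rw [div_eq_mul_inv, Complex.log_mul hab0 (inv_ne_zero ha0), Complex.log_inv _ (by linarith)]
    · ring
    · rw [Complex.arg_inv, if_neg (by linarith)]
      constructor <;> linarith
  rw [mul_div_cancel_left₀ _ ha0] at h3
  rw [h3]
  ring

theorem exists_isPolyLimit_sqrt {K : Set ℂ} [CompactSpace K] (hKc : IsPreconnected Kᶜ)
    {p : ℂ} (hp : p ∉ K) {R : ℝ} (hR : 0 < R) :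
    ∃ (q : ℂ) (s : ℂ → ℂ), R / 2 ≤ ‖q - p‖ ∧ ‖q - p‖ < R ∧ IsPolyLimit K s ∧
      (∀ z ∈ K, s z ^ 2 = (z - p) * (z - q)) ∧
      ∀ z ∈ K, R ≤ ‖z - p‖ →
        s z = (z - p) * Complex.exp (Complex.log (1 - (q - p) / (z - p)) / 2) := by
  have hK : IsCompact K := isCompact_iff_compactSpace.mpr inferInstance
  let V : Set ℂ := {q | q ∉ K ∧ ‖q - p‖ < R ∧ ∃ s : ℂ → ℂ, IsPolyLimit K s ∧
      (∀ z ∈ K, s z ^ 2 = (z - p) * (z - q)) ∧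
      ∀ z ∈ K, R ≤ ‖z - p‖ →
        s z = (z - p) * Complex.exp (Complex.log (1 - (q - p) / (z - p)) / 2)}
  have hpV : p ∈ V := by
    refine ⟨hp, by simpa using hR, fun z => z - p,
      (IsPolyLimit.id K).sub (IsPolyLimit.const K p), fun z _ => by ring, fun z _ _ => by simp⟩
  have step : ∀ q ∈ V, ∀ q' ∉ K, ‖q' - p‖ < R → (∀ z ∈ K, ‖q' - q‖ ≤ 1 / 2 * ‖z - q‖) →
      q' ∈ V := by
    rintro q ⟨hq, hqR, s, hs, hs2, hsf⟩ q' hq' hqR' hz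
    have hne : ∀ z ∈ K, z - q ≠ 0 := fun z hzK h => hq (sub_eq_zero.mp h ▸ hzK)
    have hne' : ∀ z ∈ K, z - q' ≠ 0 := fun z hzK h => hq' (sub_eq_zero.mp h ▸ hzK)
    have hb : ∀ z ∈ K, ‖(q' - q) * (z - q)⁻¹‖ ≤ 1 / 2 := fun z hzK => by
      rw [norm_mul, norm_inv, ← div_eq_mul_inv, div_le_iff₀ (norm_pos_iff.mpr (hne z hzK))]
      exact hz z hzK
    have hφ : DifferentiableOn ℂ (fun w => Complex.exp (Complex.log (1 - w) / 2))
        (Metric.ball 0 1) := by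
      intro w hw
      have hw' : 1 - w ∈ Complex.slitPlane :=
        Or.inl (Complex.re_one_sub_pos (mem_ball_zero_iff.mp hw))
      exact (((differentiableAt_id.const_sub 1).clog hw').div_const 2).cexp.differentiableWithinAt
    have key := IsPolyLimit.comp_differentiableOn hφ
      ((IsPolyLimit.const K (q' - q)).mul (IsPolyLimit.inv_sub hKc hq)) hb
    have e1 : ∀ z ∈ K, 1 - (q' - q) * (z - q)⁻¹ = (z - q') / (z - q) := fun z hzK => by
      have := hne z hzK
      field_simp
      ring
    refine ⟨hq', hqR', _, hs.mul key, fun z hzK => ?_, fun z hzK hzR => ?_⟩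
    · have := hne z hzK
      have := hne' z hzK
      rw [mul_pow, hs2 z hzK, Complex.exp_half_log_sq, e1 z hzK]
      · field_simp
      · rw [e1 z hzK]
        positivity
    · have hzp : 0 < ‖z - p‖ := hR.trans_le hzR
      have hzp' : z - p ≠ 0 := norm_pos_iff.mp hzp
      have hzq := hne z hzK
      have hr : ∀ x : ℂ, ‖x - p‖ < R → 0 < (1 - (x - p) / (z - p)).re := fun x hx => by
        apply Complex.re_one_sub_pos
        rw [norm_div, div_lt_one hzp]
        exact hx.trans_le hzR
      have e2 : (1 - (q - p) / (z - p)) * (1 - (q' - q) * (z - q)⁻¹)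
          = 1 - (q' - p) / (z - p) := by
        field_simp
        ring
      have := Complex.log_add_log_of_re_pos (hr q hqR) (b := 1 - (q' - q) * (z - q)⁻¹)
        (by rw [e2]; exact hr q' hqR')
      rw [e2] at this
      rw [hsf z hzK hzR, mul_assoc, ← Complex.exp_add, ← add_div, this]
  have hfar : ∀ x ∉ K, ∃ d > 0, ∀ z ∈ K, d ≤ ‖z - x‖ := fun x hx => by
    obtain ⟨d, hd, hdK⟩ := Metric.isOpen_iff.mp hK.isClosed.isOpen_compl x hx
    refine ⟨d, hd, fun z hz => ?_⟩
    by_contra! h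
    exact hdK (by rwa [Metric.mem_ball, dist_eq_norm]) hz
  by_contra! hcon
  have hV : ∀ q ∈ V, ‖q - p‖ < R / 2 := by
    rintro q ⟨_, hqR, s, hs, hs2, hsf⟩
    by_contra! h
    obtain ⟨z, hz, hzR, hne⟩ := hcon q s h hqR hs hs2
    exact hne (hsf z hz hzR)
  have hVo : IsOpen V := by
    rw [Metric.isOpen_iff]
    intro q hqV
    obtain ⟨d, hd, hdK⟩ := hfar q hqV.1
    refine ⟨min (d / 2) (R / 2), by positivity, fun q' hq' => ?_⟩
    rw [Metric.mem_ball, dist_eq_norm, lt_min_iff] at hq'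
    refine step q hqV q' (fun h => ?_) ?_ fun z hz => ?_
    · linarith [hdK q' h]
    · have := norm_add_le (q' - q) (q - p)
      rw [sub_add_sub_cancel] at this
      linarith [hV q hqV]
    · linarith [hdK z hz]
  have hVcl : closure V ∩ Kᶜ ⊆ V := by
    rintro x ⟨hx, hxK⟩
    obtain ⟨d, hd, hdK⟩ := hfar x hxK
    have hxR : ‖x - p‖ ≤ R / 2 := by
      have : closure V ⊆ Metric.closedBall p (R / 2) :=
        closure_minimal (fun q hq => by
          rw [Metric.mem_closedBall, dist_eq_norm]; exact (hV q hq).le) Metric.isClosed_closedBall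
      simpa [dist_eq_norm] using this hx
    obtain ⟨q, hqV, hq⟩ := Metric.mem_closure_iff.mp hx (d / 4) (by positivity)
    rw [dist_eq_norm] at hq
    refine step q hqV x hxK (by linarith) fun z hz => ?_
    have := norm_add_le (z - q) (q - x)
    rw [sub_add_sub_cancel, norm_sub_rev q x] at this
    linarith [hdK z hz]
  have hsub := hKc.subset_of_closure_inter_subset hVo ⟨p, hp, hpV⟩ hVcl
  have hb : Bornology.IsBounded (Kᶜ : Set ℂ) :=
    Metric.isBounded_ball.subset fun x hx => by
      have := hV x (hsub hx)
      rw [Metric.mem_ball, dist_eq_norm]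
      exact this
  have := hK.isBounded.union hb
  rw [union_compl_self] at this
  exact NormedSpace.unbounded_univ ℂ ℂ this

theorem exists_norm_inv_sub_sqrt_expansion_le {t σ : ℂ} (ht : ‖t‖ ≤ 1 / 2) (hσ : σ ^ 2 = 1 - t)
    (hre : 0 ≤ σ.re) :
    ∃ E : ℂ, ‖E‖ ≤ 2 * ‖t‖ ^ 2 ∧ 4 * (1 - t / 2 - σ) = t ^ 2 / 2 * (1 + t / 2 + E) := by
  have hD : 3 / 4 ≤ ‖1 - t / 2 + σ‖ := by
    refine le_trans ?_ (Complex.re_le_norm _)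
    have h1 := (Complex.re_le_norm t).trans ht
    have : (1 - t / 2 + σ).re = 1 - t.re / 2 + σ.re := by simp
    rw [this]
    linarith
  set D := 1 - t / 2 + σ with hDdef
  have hD0 : D ≠ 0 := norm_pos_iff.mp (by linarith)
  have hDi : ‖D⁻¹‖ ≤ 4 / 3 := by
    rw [norm_inv, inv_le_comm₀ (by linarith) (by norm_num)]
    linarith
  refine ⟨(t ^ 2 / 4 * D⁻¹ + t ^ 2 / 2 + t ^ 3 / 8 * D⁻¹) * D⁻¹, ?_, ?_⟩
  · have ht0 := norm_nonneg t
    have e1 : ‖t ^ 2 / 4 * D⁻¹‖ ≤ ‖t‖ ^ 2 / 4 * (4 / 3) := by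
      rw [norm_mul, norm_div, norm_pow, Complex.norm_ofNat]
      gcongr
    have e2 : ‖t ^ 2 / 2‖ = ‖t‖ ^ 2 / 2 := by
      rw [norm_div, norm_pow]
      norm_num
    have e3 : ‖t ^ 3 / 8 * D⁻¹‖ ≤ ‖t‖ ^ 2 / 16 * (4 / 3) := by
      rw [norm_mul, norm_div, norm_pow, Complex.norm_ofNat]
      have : ‖t‖ ^ 3 ≤ ‖t‖ ^ 2 * (1 / 2) := by
        rw [pow_succ]
        gcongr
      gcongr ?_ * ?_
      linarith
    calc _ ≤ (‖t‖ ^ 2 / 4 * (4 / 3) + ‖t‖ ^ 2 / 2 + ‖t‖ ^ 2 / 16 * (4 / 3)) * (4 / 3) := by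
          rw [norm_mul]
          gcongr
          refine (norm_add₃_le).trans ?_
          rw [e2]
          gcongr
      _ ≤ _ := by nlinarith [sq_nonneg ‖t‖]
  · have hs : σ = D - 1 + t / 2 := by rw [hDdef]; ring
    have h2 : (D - 1 + t / 2) ^ 2 = 1 - t := by rw [← hs]; exact hσ
    have h3 : D ^ 2 - 2 * D + t * D + t ^ 2 / 4 = 0 := by linear_combination h2
    have h4 : 1 + t / 2 + (t ^ 2 / 4 * D⁻¹ + t ^ 2 / 2 + t ^ 3 / 8 * D⁻¹) * D⁻¹ = 2 * D⁻¹ := by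
      field_simp
      linear_combination 32 * (2 + t) * h3
    have h5 : 1 - t / 2 - σ = t ^ 2 / 4 * D⁻¹ := by
      rw [hs]
      field_simp
      linear_combination (-8) * h3
    rw [h4, h5]
    ring

theorem Complex.re_exp_half_log_nonneg (w : ℂ) : 0 ≤ (Complex.exp (Complex.log w / 2)).re := by
  rw [Complex.exp_re]
  refine mul_nonneg (Real.exp_nonneg _) (Real.cos_nonneg_of_mem_Icc ?_)
  have h1 := Complex.neg_pi_lt_arg w
  have h2 := Complex.arg_le_pi w
  have : (Complex.log w / 2).im = Complex.arg w / 2 := by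
    rw [← Complex.log_im]
    simp
  rw [this]
  constructor <;> linarith


theorem norm_kernel_sub_inv_le_near {w e s u G : ℂ} (hw : ‖w‖ ≤ 8) (he : 2 ≤ ‖e‖) (he' : ‖e‖ ≤ 4)
    (hs : s ^ 2 = w * (w - e)) (hu : ‖u‖ ≤ 3) (huw : w ≠ u) (hG : G = 8 / e ^ 2 * (w - e / 2 - s)) :
    ‖G + (u - e / 2) * G ^ 2 - (w - u)⁻¹‖ ≤
      100000000 / (‖w - u‖ * (1 + ‖w - u‖ ^ 2)) := by
  have hsn : ‖s‖ ≤ 10 := by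
    have h1 : ‖s‖ ^ 2 = ‖w‖ * ‖w - e‖ := by rw [← norm_pow, hs, norm_mul]
    have h2 : ‖w - e‖ ≤ 12 := (norm_sub_le _ _).trans (by linarith)
    have h3 : ‖s‖ ^ 2 ≤ 8 * 12 := by
      rw [h1]
      gcongr
    nlinarith [norm_nonneg s]
  have he2 : ‖e / 2‖ ≤ 2 := by
    rw [norm_div, Complex.norm_ofNat]
    linarith
  have hGn : ‖G‖ ≤ 40 := by
    have h1 : ‖w - e / 2 - s‖ ≤ 20 := by
      have := norm_sub_le (w - e / 2) s
      have := norm_sub_le w (e / 2)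
      linarith
    have h2 : ‖8 / e ^ 2‖ ≤ 2 := by
      rw [norm_div, norm_pow, Complex.norm_ofNat, div_le_iff₀ (by positivity)]
      nlinarith
    rw [hG, norm_mul]
    calc _ ≤ (2 : ℝ) * 20 := by gcongr
      _ = 40 := by norm_num
  have hQ : ‖G + (u - e / 2) * G ^ 2‖ ≤ 8040 := by
    calc _ ≤ ‖G‖ + ‖u - e / 2‖ * ‖G‖ ^ 2 := by
          rw [← norm_pow, ← norm_mul]
          exact norm_add_le _ _
      _ ≤ 40 + 5 * 40 ^ 2 := by
          gcongr
          exact (norm_sub_le _ _).trans (by linarith)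
      _ = 8040 := by norm_num
  have hρ : 0 < ‖w - u‖ := norm_pos_iff.mpr (sub_ne_zero.mpr huw)
  have hρ' : ‖w - u‖ ≤ 11 := (norm_sub_le _ _).trans (by linarith)
  rw [le_div_iff₀ (by positivity)]
  calc _ ≤ (8040 + ‖w - u‖⁻¹) * (‖w - u‖ * (1 + ‖w - u‖ ^ 2)) := by
        gcongr
        refine (norm_sub_le _ _).trans ?_
        rw [norm_inv]
        gcongr
    _ = (8040 * ‖w - u‖ + 1) * (1 + ‖w - u‖ ^ 2) := by
        field_simp
    _ ≤ (8040 * 11 + 1) * (1 + 11 ^ 2) := by gcongr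
    _ ≤ _ := by norm_num

theorem norm_kernel_sub_inv_le_far {w e u σ G : ℂ} (hw : 8 ≤ ‖w‖) (he : 2 ≤ ‖e‖) (he' : ‖e‖ ≤ 4)
    (hσ : σ ^ 2 = 1 - e / w) (hre : 0 ≤ σ.re) (hu : ‖u‖ ≤ 3)
    (hG : G = 8 / e ^ 2 * (w - e / 2 - w * σ)) :
    ‖G + (u - e / 2) * G ^ 2 - (w - u)⁻¹‖ ≤
      100000000 / (‖w - u‖ * (1 + ‖w - u‖ ^ 2)) := by
  have hw0 : w ≠ 0 := norm_pos_iff.mp (by linarith)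
  have he0 : e ≠ 0 := norm_pos_iff.mp (by linarith)
  have hwp : 0 < ‖w‖ := by linarith
  have ht : ‖e / w‖ ≤ 1 / 2 := by
    rw [norm_div, div_le_iff₀ hwp]
    linarith
  obtain ⟨E, hE, hE'⟩ := exists_norm_inv_sub_sqrt_expansion_le ht hσ hre
  have hGE : G = w⁻¹ * (1 + e / w / 2 + E) := by
    have : G = 2 * w / e ^ 2 * (4 * (1 - e / w / 2 - σ)) := by
      rw [hG]
      field_simp
      ring
    rw [this, hE']
    field_simp
  have hEw : ‖E‖ ≤ 32 * ‖w‖⁻¹ ^ 2 := by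
    refine hE.trans ?_
    rw [norm_div, div_eq_mul_inv, mul_pow]
    have : ‖e‖ ^ 2 ≤ 4 ^ 2 := by gcongr
    nlinarith [sq_nonneg ‖w‖⁻¹]
  have hE1 : ‖E‖ ≤ 1 / 2 := by
    refine hE.trans ?_
    nlinarith [norm_nonneg (e / w)]
  have hx : ‖e / w / 2 + E‖ ≤ 6 * ‖w‖⁻¹ := by
    have h1 : ‖e / w / 2‖ ≤ 2 * ‖w‖⁻¹ := by
      rw [norm_div, norm_div, Complex.norm_ofNat, div_eq_mul_inv ‖e‖]
      have := inv_pos.mpr hwp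
      nlinarith
    have h2 : 32 * ‖w‖⁻¹ ^ 2 ≤ 4 * ‖w‖⁻¹ := by
      have h3 : ‖w‖⁻¹ ≤ 8⁻¹ := by gcongr
      have := inv_pos.mpr hwp
      nlinarith
    exact (norm_add_le _ _).trans (by linarith)
  have hx1 : ‖e / w / 2 + E‖ ≤ 3 / 4 := by
    refine (norm_add_le _ _).trans ?_
    rw [norm_div _ (2 : ℂ), Complex.norm_ofNat]
    linarith
  set x := e / w / 2 + E with hxdef
  have hG2 : ‖G ^ 2 - w⁻¹ ^ 2‖ ≤ 24 * ‖w‖⁻¹ ^ 3 := by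
    have : G ^ 2 - w⁻¹ ^ 2 = w⁻¹ ^ 2 * (x * (x + 2)) := by
      rw [hGE, hxdef]
      ring
    rw [this, norm_mul, norm_mul, norm_pow, norm_inv]
    have h1 : ‖x + 2‖ ≤ 4 := by
      refine (norm_add_le _ _).trans ?_
      rw [Complex.norm_ofNat]
      linarith
    calc _ ≤ ‖w‖⁻¹ ^ 2 * (6 * ‖w‖⁻¹ * 4) := by gcongr
      _ = _ := by ring
  have hρ1 : ‖w‖ / 2 ≤ ‖w - u‖ := by
    have := norm_sub_norm_le w u
    linarith
  have hρ2 : ‖w - u‖ ≤ 2 * ‖w‖ := (norm_sub_le _ _).trans (by linarith)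
  have hρ3 : 1 ≤ ‖w - u‖ := by linarith
  have hwu : w - u ≠ 0 := norm_pos_iff.mp (by linarith)
  have hdec : G + (u - e / 2) * G ^ 2 - (w - u)⁻¹ =
      w⁻¹ * E + (u - e / 2) * (G ^ 2 - w⁻¹ ^ 2) - u ^ 2 * (w⁻¹ ^ 2 * (w - u)⁻¹) := by
    have : G = w⁻¹ + (e / 2) * w⁻¹ ^ 2 + w⁻¹ * E := by
      rw [hGE]
      field_simp
    have h3 : (w - u)⁻¹ = w⁻¹ + u * w⁻¹ ^ 2 + u ^ 2 * (w⁻¹ ^ 2 * (w - u)⁻¹) := by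
      field_simp
      ring
    linear_combination this - h3
  have hinv : ‖(w - u)⁻¹‖ ≤ 2 * ‖w‖⁻¹ := by
    rw [norm_inv, inv_le_comm₀ (by linarith) (by positivity), mul_inv, inv_inv]
    linarith
  have hmain : ‖G + (u - e / 2) * G ^ 2 - (w - u)⁻¹‖ ≤ 170 * ‖w‖⁻¹ ^ 3 := by
    rw [hdec]
    refine (norm_sub_le _ _).trans ((add_le_add_left (norm_add_le _ _) _).trans ?_)
    simp only [norm_mul, norm_pow, norm_inv w]
    calc _ ≤ ‖w‖⁻¹ * (32 * ‖w‖⁻¹ ^ 2) + 5 * (24 * ‖w‖⁻¹ ^ 3)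
          + 3 ^ 2 * (‖w‖⁻¹ ^ 2 * (2 * ‖w‖⁻¹)) := by
          gcongr
          refine (norm_sub_le _ _).trans ?_
          rw [norm_div, Complex.norm_ofNat]
          linarith
      _ = _ := by ring
  refine hmain.trans ?_
  rw [le_div_iff₀ (by positivity)]
  have h1 : ‖w - u‖ * (1 + ‖w - u‖ ^ 2) ≤ 16 * ‖w‖ ^ 3 := by
    calc _ ≤ ‖w - u‖ * (‖w - u‖ ^ 2 + ‖w - u‖ ^ 2) := by
          gcongr
          exact one_le_pow₀ hρ3
      _ = 2 * ‖w - u‖ ^ 3 := by ring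
      _ ≤ 2 * (2 * ‖w‖) ^ 3 := by gcongr
      _ = _ := by ring
  calc _ ≤ 170 * ‖w‖⁻¹ ^ 3 * (16 * ‖w‖ ^ 3) := by gcongr
    _ = 2720 := by
        field_simp
        norm_num
    _ ≤ _ := by norm_num

theorem exists_isPolyLimit_kernel {K : Set ℂ} [CompactSpace K] (hKc : IsPreconnected Kᶜ)
    {p : ℂ} (hp : p ∉ K) :
    ∃ (G : ℂ → ℂ) (c : ℂ), IsPolyLimit K G ∧ ∀ ζ, ‖ζ - p‖ ≤ 3 → ∀ z ∈ K, z ≠ ζ →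
      ‖G z + (ζ - c) * G z ^ 2 - (z - ζ)⁻¹‖ ≤
        100000000 / (‖z - ζ‖ * (1 + ‖z - ζ‖ ^ 2)) := by
  obtain ⟨q, s, hq1, hq2, hs, hs2, hsf⟩ := exists_isPolyLimit_sqrt hKc hp (R := 4) (by norm_num)
  have hG : IsPolyLimit K fun z => 8 / (q - p) ^ 2 * (z - p - (q - p) / 2 - s z) :=
    (IsPolyLimit.const K _).mul
      ((((IsPolyLimit.id K).sub (.const K p)).sub (.const K ((q - p) / 2))).sub hs)
  refine ⟨_, p + (q - p) / 2, hG, fun ζ hζ z hz hzζ => ?_⟩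
  have e1 : z - ζ = (z - p) - (ζ - p) := by ring
  have e2 : ζ - (p + (q - p) / 2) = (ζ - p) - (q - p) / 2 := by ring
  rw [e1, e2]
  rcases le_total ‖z - p‖ 8 with h | h
  · refine norm_kernel_sub_inv_le_near h (by linarith) hq2.le (s := s z) ?_ hζ
      (fun h => hzζ (by simpa using h)) rfl
    rw [hs2 z hz]
    ring
  · have hz0 : 0 < ‖z - p‖ := by linarith
    refine norm_kernel_sub_inv_le_far h (by linarith) hq2.le (Complex.exp_half_log_sq ?_)
      (Complex.re_exp_half_log_nonneg _) hζ (by rw [hsf z hz (by linarith)])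
    have : ‖(q - p) / (z - p)‖ < 1 := by
      rw [norm_div, div_lt_one hz0]
      linarith
    intro h0
    have := Complex.re_one_sub_pos this
    rw [h0] at this
    simp at this

/-- The Wirtinger derivative `∂f/∂z̄`. -/
noncomputable def dbar (f : ℂ → ℂ) (z : ℂ) : ℂ :=
  (fderiv ℝ f z 1 + Complex.I * fderiv ℝ f z Complex.I) / 2

theorem integrable_inv_norm_mul_one_add_sq :
    Integrable fun w : ℂ => 1 / (‖w‖ * (1 + ‖w‖ ^ 2)) := by
  have := (integrable_fun_norm_addHaar (μ := (volume : Measure ℂ))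
    (f := fun y : ℝ => 1 / (y * (1 + y ^ 2)))).mpr
  apply this
  simp only [Complex.finrank_real_complex]
  refine (integrable_inv_one_add_sq.integrableOn (s := Ioi 0)).congr_fun ?_ measurableSet_Ioi
  intro y hy
  have hy : 0 < y := hy
  simp only [smul_eq_mul, Nat.add_one_sub_one, pow_one]
  field_simp

theorem continuous_dbar {Φ : ℂ → ℂ} (hΦ : ContDiff ℝ 1 Φ) : Continuous (dbar Φ) := by
  have := hΦ.continuous_fderiv one_ne_zero
  unfold dbar
  fun_prop

theorem hasCompactSupport_dbar {Φ : ℂ → ℂ} (hs : HasCompactSupport Φ) :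
    HasCompactSupport (dbar Φ) :=
  (hs.fderiv ℝ).mono fun z hz => by
    rw [Function.mem_support] at hz ⊢
    contrapose! hz
    simp [dbar, hz]

theorem integrable_dbar_mul_inv {Φ : ℂ → ℂ} (hΦ : ContDiff ℝ 1 Φ) (hs : HasCompactSupport Φ)
    (z : ℂ) : Integrable fun ζ => dbar Φ ζ * (z - ζ)⁻¹ := by
  have hc := continuous_dbar hΦ
  obtain ⟨M, hM⟩ : ∃ M, ∀ ζ, ‖dbar Φ ζ‖ ≤ M :=
    (hasCompactSupport_dbar hs).exists_bound_of_continuous hc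
  have hM0 : 0 ≤ M := (norm_nonneg _).trans (hM 0)
  obtain ⟨R, hR0, hR⟩ := (hasCompactSupport_dbar hs).isCompact.isBounded.exists_pos_norm_le
  refine ((integrable_inv_norm_mul_one_add_sq.comp_sub_left z).const_mul
    (M * (1 + (‖z‖ + R) ^ 2))).mono' (by fun_prop) (Eventually.of_forall fun ζ => ?_)
  by_cases h : dbar Φ ζ = 0
  · rw [h, zero_mul, norm_zero]
    positivity
  have h1 : ‖z - ζ‖ ≤ ‖z‖ + R :=
    (norm_sub_le _ _).trans (by gcongr; exact hR _ (subset_tsupport _ h))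
  have h2 : ‖z - ζ‖⁻¹ ≤ (1 + (‖z‖ + R) ^ 2) * (1 / (‖z - ζ‖ * (1 + ‖z - ζ‖ ^ 2))) := by
    rw [one_div, mul_inv, mul_comm ‖z - ζ‖⁻¹, ← mul_assoc]
    refine le_mul_of_one_le_left (by positivity) ?_
    rw [← div_eq_mul_inv, one_le_div (by positivity)]
    gcongr
  rw [norm_mul, norm_inv, mul_assoc]
  gcongr
  exact hM ζ

theorem integral_dbar_mul_inv_zero {Φ : ℂ → ℂ} (hΦ : ContDiff ℝ 1 Φ) (hs : HasCompactSupport Φ) :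
    ∫ w, dbar Φ w * w⁻¹ = -(Real.pi * Φ 0) := by
  rw [← Complex.integral_comp_polarCoord_symm]
  set e : ℝ → ℂ := fun θ => Complex.cos θ + Complex.sin θ * Complex.I with he
  have hec : Continuous e := by fun_prop
  have hee : ∀ θ, e θ = Complex.exp (θ * Complex.I) := fun θ => (Complex.exp_mul_I _).symm
  have hen : ∀ θ, ‖e θ‖ = 1 := fun θ => by rw [hee, Complex.norm_exp_ofReal_mul_I]
  have hc := hΦ.continuous_fderiv one_ne_zero
  set u : ℝ × ℝ → ℂ := fun p => fderiv ℝ Φ (p.1 * e p.2) (e p.2) with hu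
  set v : ℝ × ℝ → ℂ := fun p => fderiv ℝ Φ (p.1 * e p.2) (Complex.I * e p.2) with hv
  have huc : Continuous u := by fun_prop
  have hvc : Continuous v := by fun_prop
  have hd : ∀ x, HasFDerivAt Φ (fderiv ℝ Φ x) x := fun x =>
    (hΦ.differentiable one_ne_zero x).hasFDerivAt
  obtain ⟨R, hR0, hR⟩ : ∃ R > 0, ∀ x, R < ‖x‖ → Φ x = 0 ∧ fderiv ℝ Φ x = 0 := by
    obtain ⟨R, hR0, hR⟩ := hs.isCompact.isBounded.exists_pos_norm_le
    refine ⟨R, hR0, fun x hx => ?_⟩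
    have : x ∉ tsupport Φ := fun h => by linarith [hR x h]
    exact ⟨image_eq_zero_of_notMem_tsupport this,
      image_eq_zero_of_notMem_tsupport fun h => this (tsupport_fderiv_subset ℝ h)⟩
  have hpt : polarCoord.target = Ioi (0 : ℝ) ×ˢ Ioo (-Real.pi) Real.pi := rfl
  have h_intg : ∀ g : ℝ × ℝ → ℂ, Continuous g → (∀ p, R < p.1 → g p = 0) →
      IntegrableOn g (Ioi (0 : ℝ) ×ˢ Ioo (-Real.pi) Real.pi) := by
    intro g hg hg0
    have h1 : IntegrableOn g (Icc 0 R ×ˢ Icc (-Real.pi) Real.pi) :=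
      hg.continuousOn.integrableOn_compact (isCompact_Icc.prod isCompact_Icc)
    refine IntegrableOn.of_forall_sdiff_eq_zero h1 (measurableSet_Ioi.prod measurableSet_Ioo) ?_
    rintro ⟨r, θ⟩ ⟨h2, h3⟩
    apply hg0
    by_contra! h
    exact h3 ⟨⟨(le_of_lt h2.1), h⟩, Ioo_subset_Icc_self h2.2⟩
  have hu0 : ∀ p : ℝ × ℝ, R < p.1 → u p = 0 := fun p hp => by
    have : R < ‖(p.1 : ℂ) * e p.2‖ := by
      rw [norm_mul, hen, mul_one, Complex.norm_real]
      exact hp.trans_le (Real.le_norm_self _)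
    simp [hu, (hR _ this).2]
  have hv0 : ∀ p : ℝ × ℝ, R < p.1 → v p = 0 := fun p hp => by
    have : R < ‖(p.1 : ℂ) * e p.2‖ := by
      rw [norm_mul, hen, mul_one, Complex.norm_real]
      exact hp.trans_le (Real.le_norm_self _)
    simp [hv, (hR _ this).2]
  have hui := h_intg u huc hu0
  have hvi := h_intg v hvc hv0
  have h1 : ∫ p in Ioi (0 : ℝ) ×ˢ Ioo (-Real.pi) Real.pi, u p = -(2 * Real.pi * Φ 0) := by
    rw [Measure.volume_eq_prod] at hui ⊢
    rw [IntegrableOn, ← Measure.prod_restrict] at hui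
    rw [← Measure.prod_restrict, integral_prod_symm _ hui]
    have : ∀ θ : ℝ, ∫ r in Ioi (0 : ℝ), u (r, θ) = - Φ 0 := by
      intro θ
      have hder : ∀ r ∈ Ici (0 : ℝ), HasDerivAt (fun r : ℝ => Φ (r * e θ)) (u (r, θ)) r := by
        intro r _
        have h2 : HasDerivAt (fun r : ℝ => (r : ℂ) * e θ) (e θ) r := by
          simpa using (Complex.ofRealCLM.hasDerivAt (x := r)).mul_const (e θ)
        exact (hd _).comp_hasDerivAt r h2
      have hi : IntegrableOn (fun r : ℝ => u (r, θ)) (Ioi 0) := by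
        have h1 : IntegrableOn (fun r : ℝ => u (r, θ)) (Icc 0 R) :=
          (by fun_prop : Continuous fun r : ℝ => u (r, θ)).continuousOn.integrableOn_compact
            isCompact_Icc
        refine IntegrableOn.of_forall_sdiff_eq_zero h1 measurableSet_Ioi ?_
        rintro r ⟨h2, h3⟩
        apply hu0
        by_contra! h
        exact h3 ⟨le_of_lt h2, h⟩
      have ht : Tendsto (fun r : ℝ => Φ (r * e θ)) atTop (𝓝 0) := by
        refine tendsto_const_nhds.congr' ?_
        filter_upwards [eventually_gt_atTop R] with r hr
        refine ((hR _ ?_).1).symm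
        rw [norm_mul, hen, mul_one, Complex.norm_real]
        exact hr.trans_le (Real.le_norm_self _)
      have := integral_Ioi_of_hasDerivAt_of_tendsto' hder hi ht
      simpa using this
    simp only [this]
    simp [Real.volume_real_Ioo_of_le (show -Real.pi ≤ Real.pi by linarith [Real.pi_pos])]
    left
    ring
  have h2 : ∫ p in Ioi (0 : ℝ) ×ˢ Ioo (-Real.pi) Real.pi, v p = 0 := by
    rw [Measure.volume_eq_prod] at hvi ⊢
    rw [setIntegral_prod _ hvi]
    refine (setIntegral_congr_fun measurableSet_Ioi (g := fun _ => 0) fun r hr => ?_).trans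
      (by simp)
    have hr : (0 : ℝ) < r := hr
    have hder : ∀ θ ∈ uIcc (-Real.pi) Real.pi,
        HasDerivAt (fun θ : ℝ => (r : ℂ)⁻¹ * Φ (r * e θ)) (v (r, θ)) θ := by
      intro θ _
      have h2 : HasDerivAt (fun θ : ℝ => (r : ℂ) * e θ) (r * (Complex.I * e θ)) θ := by
        have h3 : HasDerivAt e (Complex.I * e θ) θ := by
          have h4 : HasDerivAt (fun θ : ℝ => Complex.exp (θ * Complex.I))
              (Complex.exp (θ * Complex.I) * Complex.I) θ := by
            simpa using ((Complex.ofRealCLM.hasDerivAt (x := θ)).mul_const Complex.I).cexp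
          have h5 : e = fun θ : ℝ => Complex.exp (θ * Complex.I) := funext hee
          rw [h5]
          convert! h4 using 1
          ring
        exact h3.const_mul _
      have h6 := ((hd _).comp_hasDerivAt θ h2).const_mul ((r : ℂ)⁻¹)
      convert! h6 using 1
      have : (r : ℂ) * (Complex.I * e θ) = r • (Complex.I * e θ) := by simp
      rw [this, map_smul, Complex.real_smul, ← mul_assoc, inv_mul_cancel₀ (by exact_mod_cast hr.ne'),
        one_mul]
    have h7 := intervalIntegral.integral_eq_sub_of_hasDerivAt hder
      ((by fun_prop : Continuous fun θ : ℝ => v (r, θ)).intervalIntegrable _ _)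
    rw [intervalIntegral.integral_of_le (by linarith [Real.pi_pos]),
      integral_Ioc_eq_integral_Ioo] at h7
    simp only at h7 ⊢
    rw [h7]
    simp [he]
  rw [hpt]
  have h3 : ∀ p ∈ Ioi (0 : ℝ) ×ˢ Ioo (-Real.pi) Real.pi,
      p.1 • (dbar Φ (Complex.polarCoord.symm p) * (Complex.polarCoord.symm p)⁻¹) =
      (u p + Complex.I * v p) / 2 := by
    rintro ⟨r, θ⟩ ⟨hr, -⟩
    have hr : (0 : ℝ) < r := hr
    have hr' : (r : ℂ) ≠ 0 := by exact_mod_cast hr.ne'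
    have hp : Complex.polarCoord.symm (r, θ) = r * e θ := by
      rw [Complex.polarCoord_symm_apply]
      simp [he]
    have h4 : e θ = Real.cos θ • (1 : ℂ) + Real.sin θ • Complex.I := by simp [he]
    have h5 : Complex.I * e θ = -Real.sin θ • (1 : ℂ) + Real.cos θ • Complex.I := by
      simp only [he]
      simp
      linear_combination Complex.sin θ * Complex.I_mul_I
    have h6 : (e θ)⁻¹ = Real.cos θ - Real.sin θ * Complex.I := by
      rw [hee, ← Complex.exp_neg, ← neg_mul, ← Complex.ofReal_neg, Complex.exp_mul_I]
      simp
      ring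
    have hu' : u (r, θ) = Real.cos θ * fderiv ℝ Φ (r * e θ) 1 +
        Real.sin θ * fderiv ℝ Φ (r * e θ) Complex.I := by
      simp only [hu]
      conv_lhs => rw [h4, map_add, map_smul, map_smul]
      rw [← h4]
      simp
    have hv' : v (r, θ) = -Real.sin θ * fderiv ℝ Φ (r * e θ) 1 +
        Real.cos θ * fderiv ℝ Φ (r * e θ) Complex.I := by
      simp only [hv]
      rw [h5, map_add, map_smul, map_smul]
      simp
    rw [hp, hu', hv', mul_inv, h6, Complex.real_smul, dbar]
    field_simp
    linear_combination (-Real.sin θ * fderiv ℝ Φ (r * e θ) Complex.I) * Complex.I_mul_I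
  rw [setIntegral_congr_fun (measurableSet_Ioi.prod measurableSet_Ioo) h3, integral_div,
    integral_add hui (hvi.const_mul _), integral_const_mul, h1, h2]
  ring

/-- The **Cauchy–Pompeiu formula** for compactly supported functions. -/
theorem integral_dbar_mul_inv {Φ : ℂ → ℂ} (hΦ : ContDiff ℝ 1 Φ) (hs : HasCompactSupport Φ)
    (z : ℂ) : ∫ ζ, dbar Φ ζ * (z - ζ)⁻¹ = Real.pi * Φ z := by
  have h1 := integral_dbar_mul_inv_zero (Φ := fun w => Φ (w + z)) (by fun_prop)
    (hs.comp_homeomorph (Homeomorph.addRight z))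
  have h2 : ∀ w, dbar (fun w => Φ (w + z)) w = dbar Φ (w + z) := fun w => by
    simp [dbar, fderiv_comp_add_right]
  simp only [h2, zero_add] at h1
  rw [← integral_add_right_eq_self _ z]
  rw [← neg_eq_iff_eq_neg] at h1
  rw [← h1, ← integral_neg]
  refine integral_congr_ae (Eventually.of_forall fun w => ?_)
  simp only
  rw [show z - (w + z) = -w by ring, inv_neg, mul_neg]

theorem dbar_eq_zero_of_differentiableAt {f : ℂ → ℂ} {z : ℂ} (h : DifferentiableAt ℂ f z) :
    dbar f z = 0 := by
  have h1 : fderiv ℝ f z = (fderiv ℂ f z).restrictScalars ℝ :=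
    (h.hasFDerivAt.restrictScalars ℝ).fderiv
  have h2 : fderiv ℂ f z Complex.I = Complex.I * fderiv ℂ f z 1 := by
    conv_lhs => rw [show Complex.I = Complex.I • (1 : ℂ) by simp, map_smul]
    simp
  rw [dbar, h1]
  simp only [ContinuousLinearMap.coe_restrictScalars', h2]
  linear_combination (fderiv ℂ f z 1) / 2 * Complex.I_mul_I

theorem norm_dbar_le {f : ℂ → ℂ} {z : ℂ} : ‖dbar f z‖ ≤ ‖fderiv ℝ f z‖ := by
  have h1 := (fderiv ℝ f z).le_opNorm 1
  have h2 := (fderiv ℝ f z).le_opNorm Complex.I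
  simp only [norm_one, Complex.norm_I, mul_one] at h1 h2
  rw [dbar, norm_div, Complex.norm_ofNat, div_le_iff₀ two_pos]
  refine (norm_add_le _ _).trans ?_
  rw [norm_mul, Complex.norm_I, one_mul]
  linarith

open scoped Convolution in
theorem differentiableAt_convolution_of_ball {A : ℂ → ℝ} (hA : Continuous A)
    (hAs : HasCompactSupport A) (hAb : Function.support A ⊆ Metric.ball 0 (1 / 2)) {f : ℂ → ℂ}
    (hf : Continuous f) {x₀ : ℂ} (hd : DifferentiableOn ℂ f (Metric.ball x₀ 1)) :
    DifferentiableAt ℂ (A ⋆[ContinuousLinearMap.lsmul ℝ ℝ, volume] f) x₀ := by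
  have hdc : ContinuousOn (deriv f) (Metric.ball x₀ 1) :=
    (hd.deriv Metric.isOpen_ball).continuousOn
  obtain ⟨M, hM⟩ := (isCompact_closedBall x₀ (3 / 4)).exists_bound_of_continuousOn
    (hdc.mono (Metric.closedBall_subset_ball (by norm_num)))
  have hmem : ∀ x ∈ Metric.ball x₀ (1 / 4), ∀ t, A t ≠ 0 →
      x - t ∈ Metric.closedBall x₀ (3 / 4) := by
    intro x hx t ht
    have h1 := hAb ht
    rw [mem_ball_zero_iff] at h1
    rw [mem_ball_iff_norm] at hx
    rw [mem_closedBall_iff_norm, show x - t - x₀ = (x - x₀) - t by ring]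
    linarith [norm_sub_le (x - x₀) t]
  have hAi : Integrable A := hA.integrable_of_hasCompactSupport hAs
  have key := hasDerivAt_integral_of_dominated_loc_of_deriv_le (μ := (volume : Measure ℂ))
    (F := fun x t => A t • f (x - t)) (F' := fun x t => A t • deriv f (x - t)) (x₀ := x₀)
    (s := Metric.ball x₀ (1 / 4)) (bound := fun t => ‖A t‖ * M)
    (Metric.ball_mem_nhds _ (by norm_num))
    (Eventually.of_forall fun x => (by fun_prop : Continuous _).aestronglyMeasurable)
    ((by fun_prop : Continuous fun t => A t • f (x₀ - t)).integrable_of_hasCompactSupport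
      hAs.smul_right)
    (hA.measurable.smul ((measurable_deriv f).comp (by fun_prop))).aestronglyMeasurable
    (Eventually.of_forall fun t x hx => by
      rw [norm_smul]
      by_cases h : A t = 0
      · simp [h]
      · gcongr
        exact hM _ (hmem x hx t h))
    (hAi.norm.mul_const M)
    (Eventually.of_forall fun t x hx => by
      by_cases h : A t = 0
      · simpa [h] using hasDerivAt_const x (0 : ℂ)
      · have h1 : x - t ∈ Metric.ball x₀ 1 :=
          Metric.closedBall_subset_ball (by norm_num) (hmem x hx t h)
        have h2 := (hd.differentiableAt (Metric.isOpen_ball.mem_nhds h1)).hasDerivAt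
        exact (h2.comp_sub_const x t).const_smul (A t))
  exact key.2.differentiableAt

open scoped Convolution in
theorem exists_mollification : ∃ C : ℝ, 0 ≤ C ∧ ∀ (f : ℂ → ℂ) (η : ℝ), Continuous f →
    HasCompactSupport f → (∀ x y, dist x y < 1 → dist (f x) (f y) ≤ η) →
    ∃ Φ : ℂ → ℂ, ContDiff ℝ 1 Φ ∧ HasCompactSupport Φ ∧ (∀ x, ‖Φ x - f x‖ ≤ η) ∧
      (∀ x, ‖dbar Φ x‖ ≤ C * η) ∧
      ∀ x, DifferentiableOn ℂ f (Metric.ball x 1) → dbar Φ x = 0 := by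
  set B : ContDiffBump (0 : ℂ) := ⟨1 / 4, 1 / 2, by norm_num, by norm_num⟩ with hB
  set A : ℂ → ℝ := B.normed volume with hA
  have hAc : ContDiff ℝ 1 A := B.contDiff_normed
  have hAs : HasCompactSupport A := B.hasCompactSupport_normed
  have hAb : Function.support A = Metric.ball 0 (1 / 2) := B.support_normed_eq
  have hAi : Integrable A := hAc.continuous.integrable_of_hasCompactSupport hAs
  set L : ℝ →L[ℝ] ℂ →L[ℝ] ℂ := ContinuousLinearMap.lsmul ℝ ℝ with hL
  refine ⟨‖L.precompL ℂ‖ * ∫ x, ‖fderiv ℝ A x‖, by positivity, fun f η hf hfs hη => ?_⟩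
  have hη0 : 0 ≤ η := (dist_nonneg).trans (hη 0 0 (by simp))
  refine ⟨A ⋆[L, volume] f, hAs.contDiff_convolution_left (n := 1) L hAc hf.locallyIntegrable,
    hAs.convolution L hfs, fun x => ?_, fun x => norm_dbar_le.trans ?_, fun x hx => ?_⟩
  · rw [← dist_eq_norm]
    refine B.dist_normed_convolution_le hf.aestronglyMeasurable fun y hy => hη _ _ ?_
    rw [Metric.mem_ball] at hy
    exact hy.trans (by norm_num [hB])
  · set g : ℂ → ℂ := fun y => f y - f x with hg
    have hgc : Continuous g := by fun_prop
    have h1 : (A ⋆[L, volume] f) = fun y => (A ⋆[L, volume] g) y + f x := by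
      funext y
      simp only [convolution_def, hL, ContinuousLinearMap.lsmul_apply, hg, smul_sub]
      rw [integral_sub, integral_smul_const, B.integral_normed]
      · simp
      · exact (by fun_prop : Continuous fun t => A t • f (y - t)).integrable_of_hasCompactSupport
          hAs.smul_right
      · exact hAi.smul_const _
    have h2 := (hAs.hasFDerivAt_convolution_left (μ := volume) L hAc hgc.locallyIntegrable
      x).add_const (f x)
    rw [h1, h2.fderiv]
    have h3 := dist_convolution_le' (L.precompL ℂ) (μ := (volume : Measure ℂ))
      (f := fderiv ℝ A) (g := g) (x₀ := x) (R := 1) (ε := η) (z₀ := 0) hη0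
      ((hAc.continuous_fderiv one_ne_zero).integrable_of_hasCompactSupport (hAs.fderiv ℝ)) ?_
      hgc.aestronglyMeasurable fun y hy => ?_
    · simpa using h3
    · refine (subset_tsupport _).trans ((tsupport_fderiv_subset ℝ).trans ?_)
      rw [tsupport, hAb]
      exact (closure_mono Metric.ball_subset_closedBall).trans
        (Metric.isClosed_closedBall.closure_eq.subset.trans
          (Metric.closedBall_subset_ball (by norm_num)))
    · simpa [hg, dist_eq_norm] using hη y x hy
  · exact dbar_eq_zero_of_differentiableAt
      (differentiableAt_convolution_of_ball hAc.continuous hAs hAb.subset hf hx)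

/-- A compact set in `ℂ` is partitioned measurably into finitely many pieces of diameter `< 1`. -/
theorem exists_simpleFunc_dist_lt {S : Set ℂ} (hS : IsCompact S) :
    ∃ (j : SimpleFunc ℂ ℕ) (N : ℕ), (∀ x, j x ∈ Finset.range N) ∧
      ∀ x ∈ S, ∀ y ∈ S, j x = j y → dist x y < 1 := by
  set e := TopologicalSpace.denseSeq ℂ with he
  obtain ⟨t, ht⟩ := hS.elim_finite_subcover (fun k => Metric.ball (e k) (1 / 2))
    (fun k => Metric.isOpen_ball) (fun x _ => by
      obtain ⟨y, hk, ⟨k, rfl⟩⟩ := Metric.dense_iff.mp (TopologicalSpace.denseRange_denseSeq ℂ) x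
        (1 / 2) (by norm_num)
      exact mem_iUnion.mpr ⟨_, Metric.mem_ball'.mpr hk⟩)
  set N := t.sup id with hN
  have key : ∀ x ∈ S, dist (e (SimpleFunc.nearestPtInd e N x)) x < 1 / 2 := by
    intro x hx
    obtain ⟨k, hkt, hk⟩ := mem_iUnion₂.mp (ht hx)
    have h1 := SimpleFunc.edist_nearestPt_le e x (Finset.le_sup (f := id) hkt : k ≤ N)
    rw [SimpleFunc.nearestPt, SimpleFunc.map_apply, edist_dist, edist_dist,
      ENNReal.ofReal_le_ofReal_iff dist_nonneg] at h1
    exact h1.trans_lt (Metric.mem_ball'.mp hk)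
  refine ⟨SimpleFunc.nearestPtInd e N, N + 1, fun x =>
    Finset.mem_range_succ_iff.mpr (SimpleFunc.nearestPtInd_le e N x), fun x hx y hy hxy => ?_⟩
  have h1 := key x hx
  have h2 := key y hy
  rw [hxy] at h1
  linarith [dist_triangle_left x y (e (SimpleFunc.nearestPtInd e N y))]

/-- Local smoothing and Vitushkin-type localisation: a function which oscillates by at most `η` on
unit discs and is holomorphic off the closure of `Kᶜ` is approximated up to a constant times `η`
by uniform limits of polynomials on `K`. -/
theorem exists_isPolyLimit_norm_sub_le : ∃ C : ℝ, 0 ≤ C ∧ ∀ (K : Set ℂ) [CompactSpace K],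
    IsPreconnected Kᶜ → ∀ U : Set ℂ, Uᶜ ⊆ closure Kᶜ → ∀ (f : ℂ → ℂ) (η : ℝ), Continuous f →
    HasCompactSupport f → DifferentiableOn ℂ f U →
    (∀ x y, dist x y < 1 → dist (f x) (f y) ≤ η) →
    ∃ F, IsPolyLimit K F ∧ ∀ z ∈ K, ‖f z - F z‖ ≤ C * η := by
  obtain ⟨C₁, hC₁, hmol⟩ := exists_mollification
  set k : ℂ → ℝ := fun w => 1 / (‖w‖ * (1 + ‖w‖ ^ 2)) with hk
  have hki : Integrable k := integrable_inv_norm_mul_one_add_sq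
  have hk0 : 0 ≤ ∫ w, k w := integral_nonneg fun w => by simp only [hk]; positivity
  refine ⟨1 + Real.pi⁻¹ * (C₁ * 100000000 * ∫ w, k w), by positivity, ?_⟩
  intro K _ hKc U hU f η hf hfs hfU hη
  obtain ⟨Φ, hΦ, hΦs, hΦf, hΦd, hΦ0⟩ := hmol f η hf hfs hη
  have hη0 : 0 ≤ η := (dist_nonneg).trans (hη 0 0 (by simp))
  have hdc := continuous_dbar hΦ
  have hds := hasCompactSupport_dbar hΦs
  obtain ⟨j, N, hj, hjd⟩ := exists_simpleFunc_dist_lt hds.isCompact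
  have hex : ∀ n : ℕ, ∃ (G : ℂ → ℂ) (c : ℂ), IsPolyLimit K G ∧ ∀ ζ, dbar Φ ζ ≠ 0 → j ζ = n →
      ∀ z ∈ K, z ≠ ζ → ‖G z + (ζ - c) * G z ^ 2 - (z - ζ)⁻¹‖ ≤ 100000000 * k (z - ζ) := by
    intro n
    by_cases hn : ∃ ζ₀, dbar Φ ζ₀ ≠ 0 ∧ j ζ₀ = n
    · obtain ⟨ζ₀, h0, h0n⟩ := hn
      obtain ⟨x, hx, hxU⟩ : ∃ x ∈ Metric.ball ζ₀ 1, x ∉ U := by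
        by_contra! h
        exact h0 (hΦ0 _ (hfU.mono h))
      obtain ⟨p, hpx, hpK⟩ := mem_closure_iff.mp (hU hxU) _ Metric.isOpen_ball hx
      obtain ⟨G, c, hG, hGc⟩ := exists_isPolyLimit_kernel hKc hpK
      refine ⟨G, c, hG, fun ζ hζ hζn z hz hzζ => ?_⟩
      have h1 := hjd ζ (subset_tsupport _ hζ) ζ₀ (subset_tsupport _ h0) (hζn.trans h0n.symm)
      rw [Metric.mem_ball'] at hpx
      have h2 := dist_triangle ζ ζ₀ p
      rw [dist_eq_norm ζ p] at h2
      have := hGc ζ (by linarith) z hz hzζ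
      rwa [hk, mul_one_div]
    · push Not at hn
      exact ⟨0, 0, IsPolyLimit.const K 0, fun ζ hζ hζn => absurd hζn (hn ζ hζ)⟩
  choose G c hG hGc using hex
  set g : ℕ → ℂ → ℂ → ℂ := fun n z ζ =>
    (j ⁻¹' {n}).indicator (fun ζ => dbar Φ ζ * (G n z + (ζ - c n) * G n z ^ 2)) ζ with hg
  have hd1 : Integrable (dbar Φ) := hdc.integrable_of_hasCompactSupport hds
  have hd2 : ∀ n, Integrable fun ζ => dbar Φ ζ * (ζ - c n) := fun n =>
    (by fun_prop : Continuous fun ζ => dbar Φ ζ * (ζ - c n)).integrable_of_hasCompactSupport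
      hds.mul_right
  have hgint : ∀ n z, Integrable (g n z) := fun n z => by
    refine Integrable.indicator ?_ (j.measurableSet_fiber n)
    exact (by fun_prop : Continuous fun ζ => dbar Φ ζ * (G n z + (ζ - c n) * G n z ^ 2)
      ).integrable_of_hasCompactSupport hds.mul_right
  refine ⟨fun z => (Real.pi : ℂ)⁻¹ * ∑ n ∈ Finset.range N, ∫ ζ, g n z ζ, ?_, fun z hz => ?_⟩
  · refine (IsPolyLimit.const K _).mul (IsPolyLimit.sum _ fun n _ => ?_)
    have : (fun z => ∫ ζ, g n z ζ) = fun z => (∫ ζ in j ⁻¹' {n}, dbar Φ ζ) * G n z +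
        (∫ ζ in j ⁻¹' {n}, dbar Φ ζ * (ζ - c n)) * (G n z * G n z) := by
      funext z
      simp only [hg]
      rw [integral_indicator (j.measurableSet_fiber n), ← integral_mul_const, ← integral_mul_const,
        ← integral_add (hd1.integrableOn.mul_const _) ((hd2 n).integrableOn.mul_const _)]
      exact integral_congr_ae (Eventually.of_forall fun ζ => by simp only; ring)
    rw [this]
    exact ((IsPolyLimit.const K _).mul (hG n)).add
      ((IsPolyLimit.const K _).mul ((hG n).mul (hG n)))
  · have hsum : ∀ ζ, ∑ n ∈ Finset.range N, g n z ζ =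
        dbar Φ ζ * (G (j ζ) z + (ζ - c (j ζ)) * G (j ζ) z ^ 2) := by
      intro ζ
      rw [Finset.sum_eq_single_of_mem (j ζ) (hj ζ)]
      · simp [hg]
      · intro n _ hn
        simp [hg, hn.symm]
    have hΦz : (Real.pi : ℂ)⁻¹ * ∫ ζ, dbar Φ ζ * (z - ζ)⁻¹ = Φ z := by
      rw [integral_dbar_mul_inv hΦ hΦs]
      field_simp
    have hbound : ‖∫ ζ, (∑ n ∈ Finset.range N, g n z ζ - dbar Φ ζ * (z - ζ)⁻¹)‖ ≤
        ∫ ζ, C₁ * η * 100000000 * k (z - ζ) := by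
      refine norm_integral_le_of_norm_le ((hki.comp_sub_left z).const_mul _) ?_
      filter_upwards [compl_mem_ae_iff.mpr (measure_singleton z)] with ζ hζ
      rw [hsum, ← mul_sub, norm_mul]
      by_cases h : dbar Φ ζ = 0
      · rw [h, norm_zero, zero_mul]
        simp only [hk]
        positivity
      · rw [mul_assoc (C₁ * η)]
        exact mul_le_mul (hΦd ζ) (hGc _ ζ h rfl z hz (Ne.symm hζ)) (norm_nonneg _) (by positivity)
    rw [integral_sub (integrable_finsetSum _ fun n _ => hgint n z)
      (integrable_dbar_mul_inv hΦ hΦs z), integral_finsetSum _ fun n _ => hgint n z,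
      integral_const_mul, integral_sub_left_eq_self] at hbound
    have h1 : ‖Φ z - (Real.pi : ℂ)⁻¹ * ∑ n ∈ Finset.range N, ∫ ζ, g n z ζ‖ ≤
        Real.pi⁻¹ * (C₁ * η * 100000000 * ∫ w, k w) := by
      rw [norm_sub_rev, ← hΦz, ← mul_sub, norm_mul, norm_inv, Complex.norm_real,
        Real.norm_of_nonneg Real.pi_pos.le]
      gcongr
    have h2 := norm_sub_le_norm_sub_add_norm_sub (f z) (Φ z)
      ((Real.pi : ℂ)⁻¹ * ∑ n ∈ Finset.range N, ∫ ζ, g n z ζ)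
    have h3 := hΦf z
    rw [norm_sub_rev] at h3
    nlinarith

/-- **Mergelyan's theorem** in the plane. -/
theorem exists_polynomial_norm_sub_lt {K U : Set ℂ} (hK : IsCompact K) (hKc : IsPreconnected Kᶜ)
    (hUK : U ⊆ K) (hU : Uᶜ ⊆ closure Kᶜ) {f : ℂ → ℂ} (hf : ContinuousOn f K)
    (hfU : DifferentiableOn ℂ f U) {ε : ℝ} (hε : 0 < ε) :
    ∃ p : Polynomial ℂ, ∀ z ∈ K, ‖f z - p.eval z‖ < ε := by
  obtain ⟨C, hC, happ⟩ := exists_isPolyLimit_norm_sub_le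
  obtain ⟨F, hF⟩ := ContinuousMap.exists_restrict_eq hK.isClosed ⟨K.domRestrict f, hf.domRestrict⟩
  have hF' : ∀ z ∈ K, F z = f z := fun z hz => DFunLike.congr_fun hF ⟨z, hz⟩
  obtain ⟨R, hR0, hR⟩ := hK.isBounded.exists_pos_norm_le
  set χ : ContDiffBump (0 : ℂ) := ⟨R, R + 1, hR0, by linarith⟩ with hχ
  set g : ℂ → ℂ := fun z => χ z • F z with hg
  have hgc : Continuous g := χ.continuous.smul F.continuous
  have hgs : HasCompactSupport g := χ.hasCompactSupport.smul_right
  have hgf : ∀ z ∈ K, g z = f z := fun z hz => by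
    rw [hg]
    simp only
    rw [χ.one_of_mem_closedBall (mem_closedBall_zero_iff.mpr (hR z hz)), one_smul, hF' z hz]
  obtain ⟨δ, hδ, hgδ⟩ := Metric.uniformContinuous_iff.mp
    (hgs.uniformContinuous_of_continuous hgc) (ε / (2 * (C + 1))) (by positivity)
  have hδ' : (δ : ℂ) ≠ 0 := by exact_mod_cast hδ.ne'
  set e : ℂ ≃ₜ ℂ := Homeomorph.mulLeft₀ (δ : ℂ) hδ' with he
  have hev : ∀ z, e z = δ * z := fun z => rfl
  have hcK : CompactSpace (e ⁻¹' K) := isCompact_iff_compactSpace.mp (e.isCompact_preimage.mpr hK)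
  obtain ⟨G, hG, hGb⟩ := happ (e ⁻¹' K) (by
      rw [← preimage_compl]
      exact e.isPreconnected_preimage.mpr hKc) (e ⁻¹' U) (by
      rw [← preimage_compl, ← preimage_compl, ← e.preimage_closure]
      exact preimage_mono hU) (g ∘ e) (ε / (2 * (C + 1))) (hgc.comp e.continuous)
    (hgs.comp_homeomorph e) (by
      refine DifferentiableOn.comp (t := U) (hfU.congr fun z hz => hgf z (hUK hz)) ?_
        (fun z hz => hz)
      exact (differentiable_id.const_mul (δ : ℂ)).differentiableOn)
    (fun x y hxy => by
      refine (hgδ ?_).le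
      rw [hev, hev, dist_eq_norm, ← mul_sub, norm_mul, Complex.norm_real,
        Real.norm_of_nonneg hδ.le, ← dist_eq_norm]
      exact mul_lt_of_lt_one_right hδ hxy)
  obtain ⟨p, hp⟩ := hG.exists_polynomial (half_pos hε)
  refine ⟨p.comp (Polynomial.C (δ : ℂ)⁻¹ * Polynomial.X), fun z hz => ?_⟩
  have hez : e (e.symm z) = z := e.apply_symm_apply z
  have hmem : e.symm z ∈ e ⁻¹' K := by rwa [mem_preimage, hez]
  have hes : e.symm z = (δ : ℂ)⁻¹ * z := rfl
  have h1 := hGb _ hmem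
  have h2 := hp _ hmem
  rw [Function.comp_apply, hez, hgf z hz] at h1
  have h3 : C * (ε / (2 * (C + 1))) ≤ ε / 2 := by
    rw [← mul_div_assoc, div_le_div_iff₀ (by positivity) two_pos]
    nlinarith
  have h4 := norm_sub_le_norm_sub_add_norm_sub (f z) (G (e.symm z)) (p.eval (e.symm z))
  simp only [Polynomial.eval_comp, Polynomial.eval_mul, Polynomial.eval_C, Polynomial.eval_X,
    ← hes]
  linarith

theorem Complex.eq_of_exp_eq_of_continuous {X : Type*} [TopologicalSpace X] [PreconnectedSpace X]
    {g : X → ℂ} (hg : Continuous g) (h : ∀ x y, Complex.exp (g x) = Complex.exp (g y)) (x y : X) :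
    g x = g y :=
  Complex.isCoveringMap_exp.const_of_comp hg (fun x y => Subtype.ext (h x y)) x y

theorem exists_continuous_exp_eq {E : Type*} [AddCommGroup E] [Module ℝ E] [TopologicalSpace E]
    [IsTopologicalAddGroup E] [ContinuousSMul ℝ E] [LocallyPathConnectedSpace E] {g : E → ℂ}
    (hg : Continuous g) (h0 : ∀ x, g x ≠ 0) :
    ∃ L : E → ℂ, Continuous L ∧ ∀ x, Complex.exp (L x) = g x := by
  obtain ⟨L, hL, hLg⟩ := Complex.exists_continuousOn_eqOn_exp_comp (U := (univ : Set E))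
    (by
      have := (Homeomorph.Set.univ E).contractibleSpace
      exact SimplyConnectedSpace.ofContractible _) isOpen_univ hg.continuousOn
    (by rintro ⟨x, -, hx⟩; exact h0 x hx)
  exact ⟨L, continuousOn_univ.mp hL, fun x => hLg (mem_univ x)⟩

theorem eq_zero_of_eq_zpow_near_infinity {H : ℂ → ℂ} (hH : Continuous H) (h0 : ∀ z, H z ≠ 0)
    {a : ℂ} {m : ℤ} {R : ℝ} (hR : 0 < R) (h : ∀ z, R ≤ ‖z - a‖ → H z = (z - a) ^ m) : m = 0 := by
  obtain ⟨L, hL, hLH⟩ := exists_continuous_exp_eq hH h0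
  set g : ℝ → ℂ := fun θ => L (a + R * Complex.exp (θ * Complex.I)) - m * (θ * Complex.I) with hg
  have hgc : Continuous g := by fun_prop
  have hR' : (R : ℂ) ≠ 0 := by exact_mod_cast hR.ne'
  have hge : ∀ θ, Complex.exp (g θ) = (R : ℂ) ^ m := by
    intro θ
    rw [hg, Complex.exp_sub, hLH, h _ (by
      rw [add_sub_cancel_left, norm_mul, Complex.norm_exp_ofReal_mul_I, mul_one, Complex.norm_real]
      exact Real.le_norm_self R), add_sub_cancel_left, Complex.exp_int_mul, mul_zpow,
      mul_div_assoc, div_self (zpow_ne_zero _ (Complex.exp_ne_zero _)), mul_one]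
  have h1 := Complex.eq_of_exp_eq_of_continuous hgc (fun x y => (hge x).trans (hge y).symm)
    0 (2 * Real.pi)
  simp only [hg] at h1
  push_cast at h1
  rw [Complex.exp_two_pi_mul_I] at h1
  simp only [zero_mul, Complex.exp_zero, mul_zero, sub_zero] at h1
  have h2 : (m : ℂ) * (2 * Real.pi * Complex.I) = 0 := by linear_combination h1
  have h3 : (2 * Real.pi * Complex.I : ℂ) ≠ 0 := Complex.two_pi_I_ne_zero
  exact_mod_cast (mul_eq_zero.mp h2).resolve_right h3

/-- **Eilenberg's criterion**: a power of `z - a` times a power of `z - b` has no continuous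
logarithm on the boundary of a bounded open set that contains `a` and whose closure misses `b`. -/
theorem eq_zero_of_exp_eq_on_frontier {U : Set ℂ} (hU : IsOpen U) (hUb : Bornology.IsBounded U)
    {a b : ℂ} (ha : a ∈ U) (hb : b ∉ closure U) {m n : ℤ} {h : ℂ → ℂ} (hc : Continuous h)
    (hh : ∀ z ∈ frontier U, (z - a) ^ m * (z - b) ^ n = Complex.exp (h z)) : m = 0 := by
  classical
  set H : ℂ → ℂ := fun z => if z ∈ closure U then (z - b) ^ (-n) * Complex.exp (h z) else
    (z - a) ^ m with hH
  have hnb : ∀ z ∈ closure U, z - b ≠ 0 := fun z hz h => hb (sub_eq_zero.mp h ▸ hz)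
  have hna : ∀ z ∈ closure (closure U)ᶜ, z - a ≠ 0 := fun z hz h => by
    rw [closure_compl, sub_eq_zero.mp h] at hz
    exact hz (interior_mono subset_closure (hU.interior_eq.symm ▸ ha))
  have hHc : Continuous H := by
    rw [← continuousOn_univ]
    refine ContinuousOn.if (p := fun z => z ∈ closure U) ?_ ?_ ?_
    · rintro z ⟨-, hz⟩
      have hz' : z ∈ frontier U := frontier_closure_subset hz
      rw [← hh z hz', zpow_neg]
      have := zpow_ne_zero n (hnb z hz'.1)
      field_simp
    · rw [univ_inter]
      refine ContinuousOn.mul ?_ (by fun_prop)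
      refine ContinuousOn.zpow₀ (by fun_prop) _ fun z hz => Or.inl (hnb z ?_)
      simpa using hz
    · rw [univ_inter]
      exact ContinuousOn.zpow₀ (by fun_prop) _ fun z hz => Or.inl (hna z hz)
  have hH0 : ∀ z, H z ≠ 0 := by
    intro z
    by_cases hz : z ∈ closure U
    · simp only [hH, if_pos hz]
      exact mul_ne_zero (zpow_ne_zero _ (hnb z hz)) (Complex.exp_ne_zero _)
    · simp only [hH, if_neg hz]
      exact zpow_ne_zero _ (hna z (subset_closure hz))
  obtain ⟨R, hR0, hR⟩ := hUb.closure.exists_pos_norm_le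
  refine eq_zero_of_eq_zpow_near_infinity hHc hH0 (a := a) (R := R + ‖a‖ + 1) (by positivity)
    fun z hz => if_neg fun hzU => ?_
  have := norm_sub_le z a
  linarith [hR z hzU]

theorem exists_continuous_log_circle {u : Circle → ℂ} (hu : Continuous u) (h0 : ∀ c, u c ≠ 0) :
    ∃ φ : ℝ → ℂ, Continuous φ ∧ (∀ t, Complex.exp (φ t) = u (Circle.exp t)) ∧
      ∃ p : ℤ, ∀ t, φ (t + 2 * Real.pi) = φ t + p * (2 * Real.pi * Complex.I) := by
  obtain ⟨φ, hφ, hφu⟩ := exists_continuous_exp_eq (hu.comp Circle.exp.continuous) (fun t => h0 _)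
  refine ⟨φ, hφ, hφu, ?_⟩
  have hone : ∀ t, Complex.exp (φ (t + 2 * Real.pi) - φ t) = 1 := by
    intro t
    rw [Complex.exp_sub, hφu, hφu]
    simp only [Function.comp_apply, Circle.exp_add, Circle.exp_two_pi, mul_one]
    exact div_self (h0 _)
  obtain ⟨p, hp⟩ := Complex.exp_eq_one_iff.mp (hone 0)
  refine ⟨p, fun t => ?_⟩
  have := Complex.eq_of_exp_eq_of_continuous (g := fun t => φ (t + 2 * Real.pi) - φ t)
    (by fun_prop) (fun x y => (hone x).trans (hone y).symm) t 0
  simp only [hp] at this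
  linear_combination this

theorem Circle.isQuotientMap_exp : IsQuotientMap Circle.exp :=
  Circle.isCoveringMap_exp.isOpenMap.isQuotientMap Circle.exp.continuous
    fun z => ⟨_, Circle.exp_arg z⟩

theorem exists_continuous_circle_of_periodic {χ : ℝ → ℂ} (hχ : Continuous χ)
    (hp : Function.Periodic χ (2 * Real.pi)) :
    ∃ h : Circle → ℂ, Continuous h ∧ ∀ t, h (Circle.exp t) = χ t := by
  have h1 : ∀ t, χ (Complex.arg (Circle.exp t)) = χ t := by
    intro t
    obtain ⟨m, hm⟩ := Circle.exp_eq_exp.mp (Circle.exp_arg (Circle.exp t))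
    rw [hm]
    exact hp.int_mul m t
  refine ⟨fun c => χ (Complex.arg c), ?_, h1⟩
  rw [Circle.isQuotientMap_exp.continuous_iff]
  exact hχ.congr fun t => (h1 t).symm

/-- Two nonvanishing functions on the circle are multiplicatively dependent modulo exponentials. -/
theorem exists_zpow_mul_zpow_eq_exp {u v : Circle → ℂ} (hu : Continuous u) (hv : Continuous v)
    (hu0 : ∀ c, u c ≠ 0) (hv0 : ∀ c, v c ≠ 0) :
    ∃ m n : ℤ, (m ≠ 0 ∨ n ≠ 0) ∧ ∃ h : Circle → ℂ, Continuous h ∧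
      ∀ c, u c ^ m * v c ^ n = Complex.exp (h c) := by
  obtain ⟨φ, hφ, hφu, p, hp⟩ := exists_continuous_log_circle hu hu0
  obtain ⟨ψ, hψ, hψv, q, hq⟩ := exists_continuous_log_circle hv hv0
  have key : ∀ m n : ℤ, m * p + n * q = 0 → ∃ h : Circle → ℂ, Continuous h ∧
      ∀ c, u c ^ m * v c ^ n = Complex.exp (h c) := by
    intro m n hmn
    obtain ⟨h, hc, hh⟩ := exists_continuous_circle_of_periodic
      (χ := fun t => m * φ t + n * ψ t) (by fun_prop) fun t => by
        have : (m * p + n * q : ℂ) = 0 := by exact_mod_cast hmn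
        simp only [hp, hq]
        linear_combination (2 * Real.pi * Complex.I) * this
    refine ⟨h, hc, fun c => ?_⟩
    obtain ⟨t, rfl⟩ := Circle.isQuotientMap_exp.surjective c
    rw [hh, Complex.exp_add, Complex.exp_int_mul, Complex.exp_int_mul, hφu, hψv]
  by_cases h : p = 0
  · exact ⟨1, 0, by simp, key 1 0 (by simp [h])⟩
  · exact ⟨q, -p, by simp [h], key q (-p) (by ring)⟩

theorem Complex.isPreconnected_norm_gt {R : ℝ} (hR : 0 < R) :
    IsPreconnected {z : ℂ | R < ‖z‖} := by
  have : {z : ℂ | R < ‖z‖} = Complex.exp '' (Complex.re ⁻¹' Ioi (Real.log R)) := by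
    ext z
    simp only [mem_ofPred_eq, mem_image, mem_preimage, mem_Ioi]
    constructor
    · intro hz
      have hz0 : z ≠ 0 := norm_pos_iff.mp (hR.trans hz)
      exact ⟨Complex.log z, by rw [Complex.log_re]; exact Real.log_lt_log hR hz,
        Complex.exp_log hz0⟩
    · rintro ⟨w, hw, rfl⟩
      rw [Complex.norm_exp]
      exact (Real.log_lt_iff_lt_exp hR).mp hw
  rw [this]
  exact ((convex_halfSpace_re_gt _).isPreconnected).image _ Complex.continuous_exp.continuousOn

/-- If the complement of a bounded set is disconnected and open, it has a bounded component. -/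
theorem exists_isBounded_connectedComponentIn {W : Set ℂ} (hW : Bornology.IsBounded Wᶜ)
    (hWc : ¬ IsPreconnected W) : ∃ b ∈ W, Bornology.IsBounded (connectedComponentIn W b) := by
  by_contra! h
  obtain ⟨R, hR0, hR⟩ := hW.exists_pos_norm_le
  set E := {z : ℂ | R < ‖z‖} with hE
  have hEW : E ⊆ W := fun z hz => by
    by_contra hzW
    exact absurd (hR z hzW) (not_le.mpr hz)
  obtain ⟨e, he⟩ : E.Nonempty := ⟨((R + 1 : ℝ) : ℂ), by
    rw [hE, mem_ofPred_eq, Complex.norm_real, Real.norm_of_nonneg (by positivity)]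
    linarith⟩
  have key : ∀ b ∈ W, b ∈ connectedComponentIn W e := by
    intro b hb
    obtain ⟨x, hx, hxE⟩ : ∃ x ∈ connectedComponentIn W b, x ∈ E := by
      by_contra! h'
      refine h b hb (isBounded_iff_forall_norm_le.mpr ⟨R, fun x hx => ?_⟩)
      exact not_lt.mp (h' x hx)
    have h1 : e ∈ connectedComponentIn W x :=
      (Complex.isPreconnected_norm_gt hR0).subset_connectedComponentIn hxE hEW he
    rw [← connectedComponentIn_eq h1, ← connectedComponentIn_eq hx]
    exact mem_connectedComponentIn hb
  apply hWc
  have : W = connectedComponentIn W e :=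
    Subset.antisymm key (connectedComponentIn_subset W e)
  rw [this]
  exact isPreconnected_connectedComponentIn

theorem IsOpen.frontier_connectedComponentIn_subset {X : Type*} [TopologicalSpace X]
    [LocallyConnectedSpace X] {W : Set X} (hW : IsOpen W) (b : X) :
    frontier (connectedComponentIn W b) ⊆ Wᶜ := by
  intro x hx hxW
  obtain ⟨y, hy, hyb⟩ := mem_closure_iff.mp hx.1 _ (hW.connectedComponentIn (x := x))
    (mem_connectedComponentIn hxW)
  have h1 := mem_connectedComponentIn hxW
  rw [connectedComponentIn_eq hy, ← connectedComponentIn_eq hyb] at h1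
  exact hx.2 ((hW.connectedComponentIn).interior_eq.symm ▸ h1)

section Jordan

variable {Ω : Set ℂ} {γ : Circle → ℂ}

/-- The complement of a closed Jordan region is connected. -/
theorem isPreconnected_compl_closure_of_frontier_eq_range (hΩ : IsOpen Ω)
    (hΩb : Bornology.IsBounded Ω) (hne : Ω.Nonempty) (hγ : Continuous γ)
    (hinj : Function.Injective γ) (hfr : range γ = frontier Ω) :
    IsPreconnected (closure Ω)ᶜ := by
  by_contra hWc
  have hW : IsOpen (closure Ω)ᶜ := isClosed_closure.isOpen_compl
  obtain ⟨b, hb, hVb⟩ := exists_isBounded_connectedComponentIn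
    (by rw [compl_compl]; exact hΩb.closure) hWc
  set V := connectedComponentIn (closure Ω)ᶜ b with hV
  have hVo : IsOpen V := hW.connectedComponentIn
  have hbV : b ∈ V := mem_connectedComponentIn hb
  have hVW : V ⊆ (closure Ω)ᶜ := connectedComponentIn_subset _ _
  have hdisj : Disjoint Ω V := disjoint_left.mpr fun x hx hxV => hVW hxV (subset_closure hx)
  have hdisj' : Disjoint Ω (closure V) := hdisj.closure_right hΩ
  have hfrV : frontier V ⊆ frontier Ω := fun x hx => by
    have h1 := hW.frontier_connectedComponentIn_subset b hx
    rw [compl_compl] at h1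
    rw [hΩ.frontier_eq]
    exact ⟨h1, fun h2 => disjoint_left.mp hdisj' h2 hx.1⟩
  obtain ⟨a, ha⟩ := hne
  have hγΩ : ∀ c, γ c ∈ frontier Ω := fun c => hfr ▸ mem_range_self c
  have hua : ∀ c, γ c - a ≠ 0 := fun c h => by
    have := hγΩ c
    rw [hΩ.frontier_eq, sub_eq_zero.mp h] at this
    exact this.2 ha
  have hvb : ∀ c, γ c - b ≠ 0 := fun c h => by
    have := (hγΩ c).1
    rw [sub_eq_zero.mp h] at this
    exact hb this
  obtain ⟨m, n, hmn, h, hh, hheq⟩ := exists_zpow_mul_zpow_eq_exp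
    (hγ.sub continuous_const) (hγ.sub continuous_const) hua hvb
  obtain ⟨g, hg⟩ := ContinuousMap.exists_extension (hγ.isClosedEmbedding hinj)
    (⟨h, hh⟩ : C(Circle, ℂ))
  have hg' : ∀ z ∈ frontier Ω, (z - a) ^ m * (z - b) ^ n = Complex.exp (g z) := by
    rw [← hfr]
    rintro _ ⟨c, rfl⟩
    refine (hheq c).trans ?_
    exact congrArg _ (DFunLike.congr_fun hg c).symm
  rcases hmn with hm | hn
  · exact hm (eq_zero_of_exp_eq_on_frontier hΩ hΩb ha hb g.continuous hg')
  · refine hn (eq_zero_of_exp_eq_on_frontier hVo hVb hbV (b := a) (n := m)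
      (fun h => disjoint_left.mp hdisj' ha h) g.continuous fun z hz => ?_)
    rw [mul_comm]
    exact hg' z (hfrV hz)

/-- A proper arc of a Jordan curve does not wind around any point. -/
theorem exists_continuous_exp_eq_off_arc (hγ : Continuous γ) {a : ℂ}
    (ha : ∀ c, γ c ≠ a) (hinj : Function.Injective γ) {N : Set Circle} (hN : IsOpen N)
    (hNne : N.Nonempty) :
    ∃ g : ℂ → ℂ, Continuous g ∧ ∀ c ∉ N, γ c - a = Complex.exp (g (γ c)) := by
  obtain ⟨c₀, hc₀⟩ := hNne
  obtain ⟨φ, hφ, hφu, -⟩ := exists_continuous_log_circle (hγ.sub continuous_const)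
    (fun c => sub_ne_zero.mpr (ha c))
  set h : Circle → ℂ := fun c => φ (Complex.arg (-(c / c₀ : Circle)) + (Complex.arg c₀ + Real.pi))
    with hh
  have hexp : ∀ c, Complex.exp (h c) = γ c - a := by
    intro c
    simp only [hh]
    rw [hφu]
    suffices Circle.exp (Complex.arg (-(c / c₀ : Circle)) + (Complex.arg c₀ + Real.pi)) = c by
      rw [this]
      rfl
    apply Circle.ext
    rw [Circle.coe_exp]
    rw [Complex.ofReal_add, Complex.ofReal_add, add_mul, add_mul, Complex.exp_add, Complex.exp_add, Complex.exp_pi_mul_I]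
    have e1 : ∀ z : ℂ, ‖z‖ = 1 → Complex.exp (Complex.arg z * Complex.I) = z := fun z hz => by
      have := Complex.norm_mul_exp_arg_mul_I z
      rwa [hz, Complex.ofReal_one, one_mul] at this
    rw [e1 _ (by rw [norm_neg, Circle.norm_coe]), e1 _ (Circle.norm_coe c₀), Circle.coe_div]
    have := Circle.coe_ne_zero c₀
    field_simp
  have hcont : ContinuousOn h Nᶜ := by
    intro c hc
    have hcc : c ≠ c₀ := fun h => hc (h ▸ hc₀)
    have hmem : (-((c / c₀ : Circle) : ℂ)) ∈ Complex.slitPlane := by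
      rw [Complex.mem_slitPlane_iff_arg]
      refine ⟨fun harg => hcc ?_, neg_ne_zero.mpr (Circle.coe_ne_zero _)⟩
      have := Complex.norm_mul_exp_arg_mul_I (-((c / c₀ : Circle) : ℂ))
      rw [harg, Complex.exp_pi_mul_I, norm_neg, Circle.norm_coe, Complex.ofReal_one, one_mul,
        neg_inj] at this
      exact div_eq_one.mp (Circle.coe_eq_one.mp this.symm)
    refine ContinuousAt.continuousWithinAt ?_
    refine hφ.continuousAt.comp (ContinuousAt.add ?_ continuousAt_const)
    exact ContinuousAt.comp (f := fun c : Circle => -((c / c₀ : Circle) : ℂ))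
      (Complex.continuousAt_arg hmem) (by fun_prop : Continuous fun c : Circle => -((c / c₀ : Circle) : ℂ)).continuousAt
  have hcomp : CompactSpace ↥Nᶜ := isCompact_iff_compactSpace.mp hN.isClosed_compl.isCompact
  obtain ⟨g, hg⟩ := ContinuousMap.exists_extension
    ((hγ.comp continuous_subtype_val).isClosedEmbedding (X := ↥Nᶜ)
      (hinj.comp Subtype.val_injective)) ⟨Nᶜ.domRestrict h, hcont.domRestrict⟩
  refine ⟨g, g.continuous, fun c hc => ?_⟩
  rw [← hexp]
  exact congrArg _ (DFunLike.congr_fun hg ⟨c, hc⟩).symm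

/-- Every boundary point of a Jordan region is a limit of exterior points. -/
theorem compl_subset_closure_compl_closure (hΩ : IsOpen Ω)
    (hΩb : Bornology.IsBounded Ω) (hγ : Continuous γ)
    (hinj : Function.Injective γ) (hfr : range γ = frontier Ω) :
    Ωᶜ ⊆ closure (closure Ω)ᶜ := by
  intro x hx
  rw [closure_compl]
  intro hxi
  set D := interior (closure Ω) with hD
  have hDo : IsOpen D := isOpen_interior
  have hxf : x ∈ frontier Ω := by
    rw [hΩ.frontier_eq]
    exact ⟨interior_subset hxi, hx⟩
  obtain ⟨c₀, rfl⟩ := hfr ▸ hxf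
  have hΩD : Ω ⊆ D := interior_maximal subset_closure hΩ
  obtain ⟨a, ha⟩ : Ω.Nonempty := closure_nonempty_iff.mp ⟨_, hxf.1⟩
  have hfa : ∀ c, γ c ≠ a := fun c h => by
    have : γ c ∈ frontier Ω := hfr ▸ mem_range_self c
    rw [hΩ.frontier_eq] at this
    exact this.2 (h ▸ ha)
  obtain ⟨g, hg, hgeq⟩ := exists_continuous_exp_eq_off_arc hγ hfa hinj (hDo.preimage hγ) ⟨c₀, hxi⟩
  have hDb : Bornology.IsBounded D := hΩb.closure.subset interior_subset
  obtain ⟨b, hb⟩ : ∃ b, b ∉ closure D := by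
    by_contra! h
    exact NormedSpace.unbounded_univ ℝ ℂ (hDb.closure.subset fun b _ => h b)
  refine one_ne_zero (eq_zero_of_exp_eq_on_frontier hDo hDb (hΩD ha) hb (m := 1) (n := 0) hg
    fun z hz => ?_)
  rw [hDo.frontier_eq] at hz
  have hzf : z ∈ frontier Ω := by
    rw [hΩ.frontier_eq]
    exact ⟨closure_minimal interior_subset isClosed_closure hz.1, fun h => hz.2 (hΩD h)⟩
  obtain ⟨c, rfl⟩ := hfr ▸ hzf
  rw [zpow_one, zpow_zero, mul_one]
  exact hgeq c hz.2

end Jordan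

section Slice

open scoped Quaternion ComplexConjugate

/-- The parametrization `x + i y ↦ x + y J` of the slice plane of `J`. -/
noncomputable def sliceMap (J : ℍ[ℝ]) (z : ℂ) : ℍ[ℝ] := (z.re : ℍ[ℝ]) + z.im • J

/-- The real linear functional `q ↦ re (q c) - i re (J q c)`; it turns left multiplication by `J`
into multiplication by `i`. -/
noncomputable def sliceFunctional (J c : ℍ[ℝ]) : ℍ[ℝ] →L[ℝ] ℂ :=
  LinearMap.toContinuousLinearMap
    { toFun := fun q => ⟨(q * c).re, -(J * q * c).re⟩
      map_add' := fun p q => by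
        apply Complex.ext
        · simp [add_mul]
        · simp only [mul_add, add_mul, Quaternion.re_add, neg_add, Complex.add_im]
      map_smul' := fun r q => by
        apply Complex.ext
        · simp [mul_assoc]
        · simp only [mul_smul_comm, smul_mul_assoc, Quaternion.re_smul, RingHom.id_apply,
            Complex.smul_im, smul_eq_mul, mul_neg] }

variable {J I : ℍ[ℝ]}

theorem sliceFunctional_apply (J c q : ℍ[ℝ]) :
    sliceFunctional J c q = ⟨(q * c).re, -(J * q * c).re⟩ := rfl

theorem sliceFunctional_mul (hJ : J ^ 2 = -1) (c q : ℍ[ℝ]) :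
    sliceFunctional J c (J * q) = Complex.I * sliceFunctional J c q := by
  rw [sliceFunctional_apply, sliceFunctional_apply, ← mul_assoc, ← sq, hJ]
  apply Complex.ext <;> simp

theorem eq_zero_of_sliceFunctional_eq_zero {q : ℍ[ℝ]} (h : ∀ c, sliceFunctional J c q = 0) :
    q = 0 := by
  have h1 := congrArg Complex.re (h (star q))
  rw [sliceFunctional_apply, Quaternion.self_mul_star] at h1
  exact Quaternion.normSq_eq_zero.mp (by simpa using h1)

theorem sliceMap_zero (J : ℍ[ℝ]) : sliceMap J 0 = 0 := by simp [sliceMap]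

theorem sliceMap_add (J : ℍ[ℝ]) (z w : ℂ) : sliceMap J (z + w) = sliceMap J z + sliceMap J w := by
  simp only [sliceMap, Complex.add_re, Complex.add_im, Quaternion.coe_add, add_smul]
  abel

theorem sliceMap_sub (J : ℍ[ℝ]) (z w : ℂ) : sliceMap J (z - w) = sliceMap J z - sliceMap J w := by
  rw [eq_sub_iff_add_eq, ← sliceMap_add, sub_add_cancel]

theorem sliceMap_sum (J : ℍ[ℝ]) {ι : Type*} (s : Finset ι) (g : ι → ℂ) :
    sliceMap J (∑ k ∈ s, g k) = ∑ k ∈ s, sliceMap J (g k) :=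
  map_sum (⟨⟨sliceMap J, sliceMap_zero J⟩, sliceMap_add J⟩ : ℂ →+ ℍ[ℝ]) g s

theorem normSq_sliceUnit (hJ : J ^ 2 = -1) : J.re = 0 ∧ ‖J‖ = 1 := by
  have h1 : ‖J‖ ^ 2 = 1 := by rw [← norm_pow, hJ, norm_neg, norm_one]
  have h2 : ‖J‖ = 1 := (pow_eq_one_iff_of_nonneg (norm_nonneg J) two_ne_zero).mp h1
  refine ⟨?_, h2⟩
  have hn : Quaternion.normSq J = 1 := by rw [Quaternion.normSq_eq_norm_mul_self, h2, mul_one]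
  rw [Quaternion.normSq_def'] at hn
  have h3 := congrArg QuaternionAlgebra.re hJ
  rw [sq] at h3
  simp only [Quaternion.re_mul, Quaternion.re_neg, Quaternion.re_one] at h3
  nlinarith

theorem sliceMap_mul (hJ : J ^ 2 = -1) (z w : ℂ) :
    sliceMap J (z * w) = sliceMap J z * sliceMap J w := by
  have hJ' : J * J = -1 := by rw [← sq, hJ]
  have h (z : ℂ) : sliceMap J z = z.re • (1 : ℍ[ℝ]) + z.im • J := by
    rw [sliceMap, ← Quaternion.coe_mul_eq_smul z.re, mul_one]
  simp only [h, Complex.mul_re, Complex.mul_im, add_mul, mul_add, smul_mul_smul_comm, hJ',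
    mul_one, one_mul]
  module

theorem sliceMap_pow (hJ : J ^ 2 = -1) (z : ℂ) (k : ℕ) : sliceMap J (z ^ k) = sliceMap J z ^ k := by
  induction k with
  | zero => simp [sliceMap]
  | succ k ih => rw [pow_succ, pow_succ, sliceMap_mul hJ, ih]

theorem norm_sliceMap (hJ : J ^ 2 = -1) (z : ℂ) : ‖sliceMap J z‖ = ‖z‖ := by
  obtain ⟨h0, h1⟩ := normSq_sliceUnit hJ
  have hn : Quaternion.normSq J = 1 := by rw [Quaternion.normSq_eq_norm_mul_self, h1, mul_one]
  rw [Quaternion.normSq_def', h0] at hn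
  rw [← sq_eq_sq₀ (norm_nonneg _) (norm_nonneg _), ← Complex.normSq_eq_norm_sq, sq,
    ← Quaternion.normSq_eq_norm_mul_self, Quaternion.normSq_def', Complex.normSq_apply]
  simp only [sliceMap, Quaternion.re_add, Quaternion.re_coe, Quaternion.re_smul, h0,
    Quaternion.imI_add, Quaternion.imJ_add, Quaternion.imK_add, Quaternion.imI_coe,
    Quaternion.imJ_coe, Quaternion.imK_coe, Quaternion.imI_smul, Quaternion.imJ_smul,
    Quaternion.imK_smul, smul_eq_mul]
  linear_combination z.im ^ 2 * hn

theorem sliceMap_eq_representation (hI : I ^ 2 = -1) (z : ℂ) :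
    2 * sliceMap J z = (1 - J * I) * sliceMap I z + (1 + J * I) * sliceMap I (conj z) := by
  have hI' : I * I = -1 := by rw [← sq, hI]
  have h (K : ℍ[ℝ]) (z : ℂ) : sliceMap K z = z.re • (1 : ℍ[ℝ]) + z.im • K := by
    rw [sliceMap, ← Quaternion.coe_mul_eq_smul z.re, mul_one]
  simp only [h, Complex.conj_re, Complex.conj_im, sub_mul, add_mul, mul_add, one_mul,
    mul_smul_comm, mul_assoc, hI', mul_neg, mul_one, ← one_add_one_eq_two]

  module

theorem exists_sliceMap_eq (hI : I ^ 2 = -1) (q : ℍ[ℝ]) : ∃ J z, J ^ 2 = -1 ∧ sliceMap J z = q := by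
  by_cases h : q.im = 0
  · refine ⟨I, q.re, hI, ?_⟩
    simp only [sliceMap, Complex.ofReal_re, Complex.ofReal_im, zero_smul, add_zero]
    conv_rhs => rw [← Quaternion.re_add_im q, h, add_zero]
  · have hn : ‖q.im‖ ≠ 0 := norm_ne_zero_iff.mpr h
    refine ⟨‖q.im‖⁻¹ • q.im, ⟨q.re, ‖q.im‖⟩, ?_, ?_⟩
    · rw [smul_pow, Quaternion.im_sq, Quaternion.normSq_eq_norm_mul_self, smul_neg,
        Quaternion.smul_coe, neg_inj, ← Quaternion.coe_one]
      congr 1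
      field_simp
    · rw [sliceMap, smul_smul, mul_inv_cancel₀ hn, one_smul, Quaternion.re_add_im]

theorem continuous_sliceMap (J : ℍ[ℝ]) : Continuous (sliceMap J) := by
  unfold sliceMap
  have := Quaternion.continuous_coe
  fun_prop

theorem differentiable_sliceMap (J : ℍ[ℝ]) : Differentiable ℝ (sliceMap J) := by
  intro z
  have h1 : sliceMap J = fun z : ℂ => Complex.reCLM z • (1 : ℍ[ℝ]) + Complex.imCLM z • J := by
    funext z
    simp [sliceMap, ← Quaternion.coe_mul_eq_smul]
  rw [h1]
  fun_prop

theorem AxiallySymmetric.sliceMap_mem_iff {T : Set ℍ[ℝ]} (hT : AxiallySymmetric T)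
    (hI : I ^ 2 = -1) (hJ : J ^ 2 = -1) (z : ℂ) : sliceMap J z ∈ T ↔ sliceMap I z ∈ T :=
  ⟨hT _ _ J I hJ hI, hT _ _ I J hI hJ⟩

theorem AxiallySymmetric.sliceMap_conj_mem_iff {T : Set ℍ[ℝ]} (hT : AxiallySymmetric T)
    (hI : I ^ 2 = -1) (z : ℂ) : sliceMap I (conj z) ∈ T ↔ sliceMap I z ∈ T := by
  have h : sliceMap I (conj z) = sliceMap (-I) z := by simp [sliceMap]
  rw [h, hT.sliceMap_mem_iff hI (by rw [neg_sq, hI])]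

theorem SliceRegularOn.comp_sliceMap {T : Set ℍ[ℝ]} (hT : IsOpen T) {f : ℍ[ℝ] → ℍ[ℝ]}
    (hf : SliceRegularOn f T) (hJ : J ^ 2 = -1) {z : ℂ} (hz : sliceMap J z ∈ T) :
    DifferentiableAt ℝ (fun w => f (sliceMap J w)) z ∧
      fderiv ℝ (fun w => f (sliceMap J w)) z Complex.I =
        J * fderiv ℝ (fun w => f (sliceMap J w)) z 1 := by
  have hd : DifferentiableAt ℝ (fun w => f (sliceMap J w)) z :=
    ((hf.1.differentiableAt (hT.mem_nhds hz)).comp z (differentiable_sliceMap J z) :)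
  refine ⟨hd, ?_⟩
  have h1 := hf.2 J hJ z.re z.im hz
  set e := Complex.equivRealProdCLM
  have h2 : (fun p : ℝ × ℝ => f ((p.1 : ℍ[ℝ]) + p.2 • J)) =
      (fun w => f (sliceMap J w)) ∘ e.symm := by
    funext p
    simp [sliceMap, e]
  have hez : e.symm (z.re, z.im) = z := e.symm_apply_apply z
  have h3 : ∀ v, fderiv ℝ (fun p : ℝ × ℝ => f ((p.1 : ℍ[ℝ]) + p.2 • J)) (z.re, z.im) v =
      fderiv ℝ (fun w => f (sliceMap J w)) z (e.symm v) := by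
    intro v
    rw [h2, e.symm.comp_right_fderiv, hez]
    rfl
  rw [h3, h3, show e.symm (1, 0) = 1 by simp [e, Complex.ext_iff],
    show e.symm (0, 1) = Complex.I by simp [e, Complex.ext_iff]] at h1
  have hJ' : J * J = -1 := by rw [← sq, hJ]
  have h4 := congrArg (J * ·) h1
  simp only [mul_add, ← mul_assoc, hJ', mul_zero, neg_mul, one_mul] at h4
  exact (add_neg_eq_zero.mp h4).symm

theorem differentiableAt_comp_of_fderiv_eq {g : ℂ → ℍ[ℝ]} {z : ℂ} (hg : DifferentiableAt ℝ g z)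
    (h : fderiv ℝ g z Complex.I = J * fderiv ℝ g z 1) {L : ℍ[ℝ] →L[ℝ] ℂ}
    (hL : ∀ q, L (J * q) = Complex.I * L q) : DifferentiableAt ℂ (fun w => L (g w)) z := by
  rw [differentiableAt_complex_iff_differentiableAt_real]
  refine ⟨L.differentiableAt.comp z hg, ?_⟩
  have : fderiv ℝ (fun w => L (g w)) z = L.comp (fderiv ℝ g z) :=
    (L.hasFDerivAt.comp z hg.hasFDerivAt).fderiv
  rw [this]
  simp [h, hL]

end Slice

section Representation

open scoped Quaternion ComplexConjugate

variable {J I : ℍ[ℝ]}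

theorem sliceMap_conj (I : ℍ[ℝ]) (z : ℂ) : sliceMap I (conj z) = sliceMap (-I) z := by
  simp [sliceMap]

theorem isometry_sliceMap (hJ : J ^ 2 = -1) : Isometry (sliceMap J) :=
  Isometry.of_dist_eq fun z w => by
    rw [dist_eq_norm, dist_eq_norm, ← sliceMap_sub, norm_sliceMap hJ]

theorem range_sliceMap (J : ℍ[ℝ]) : range (sliceMap J) = slicePlane J := by
  ext q
  constructor
  · rintro ⟨z, rfl⟩
    exact ⟨z.re, z.im, rfl⟩
  · rintro ⟨x, y, rfl⟩
    exact ⟨⟨x, y⟩, rfl⟩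

theorem sliceMap_ofReal (J : ℍ[ℝ]) (t : ℝ) : sliceMap J t = t := by
  simp [sliceMap]

theorem norm_one_add_mul_le (hI : I ^ 2 = -1) (hJ : J ^ 2 = -1) : ‖1 + J * I‖ ≤ 2 := by
  calc ‖1 + J * I‖ ≤ ‖(1 : ℍ[ℝ])‖ + ‖J * I‖ := norm_add_le _ _
    _ = 2 := by
      rw [norm_mul, (normSq_sliceUnit hI).2, (normSq_sliceUnit hJ).2, norm_one]
      norm_num

/-- The representation formula for slice regular functions. -/
theorem SliceRegularOn.representation {T : Set ℍ[ℝ]} (hTo : IsOpen T) (hT : AxiallySymmetric T)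
    {f : ℍ[ℝ] → ℍ[ℝ]} (hf : SliceRegularOn f T) (hI : I ^ 2 = -1) (hJ : J ^ 2 = -1)
    (hpre : IsPreconnected (sliceMap I ⁻¹' T)) {x : ℝ} (hx : (x : ℍ[ℝ]) ∈ T) {z : ℂ}
    (hz : sliceMap I z ∈ T) :
    2 * f (sliceMap J z) =
      (1 - J * I) * f (sliceMap I z) + (1 + J * I) * f (sliceMap I (conj z)) := by
  have hI' : I * I = -1 := by rw [← sq, hI]
  have hJ' : J * J = -1 := by rw [← sq, hJ]
  have hIn : (-I) ^ 2 = -1 := by rw [neg_sq, hI]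
  set D : ℂ → ℍ[ℝ] := fun w => 2 * f (sliceMap J w) -
    ((1 - J * I) * f (sliceMap I w) + (1 + J * I) * f (sliceMap (-I) w)) with hD
  have hΩ : IsOpen (sliceMap I ⁻¹' T) := hTo.preimage (continuous_sliceMap I)
  have hD' : ∀ w ∈ sliceMap I ⁻¹' T, DifferentiableAt ℝ D w ∧
      fderiv ℝ D w Complex.I = J * fderiv ℝ D w 1 := by
    intro w hw
    obtain ⟨h1, h1'⟩ := hf.comp_sliceMap hTo hJ ((hT.sliceMap_mem_iff hI hJ w).mpr hw)
    obtain ⟨h2, h2'⟩ := hf.comp_sliceMap hTo hI hw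
    obtain ⟨h3, h3'⟩ := hf.comp_sliceMap hTo hIn ((hT.sliceMap_mem_iff hI hIn w).mpr hw)
    have hd := (h1.hasFDerivAt.const_mul 2).sub
      ((h2.hasFDerivAt.const_mul (1 - J * I)).add (h3.hasFDerivAt.const_mul (1 + J * I)))
    have hd' : HasFDerivAt D _ w := hd
    refine ⟨hd'.differentiableAt, ?_⟩
    rw [hd'.fderiv]
    simp only [sub_apply, add_apply,
      smul_apply, smul_eq_mul, h1', h2', h3', neg_mul, mul_neg]
    have e1 : (1 - J * I) * (I * fderiv ℝ (fun w => f (sliceMap I w)) w 1) =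
        (I + J) * fderiv ℝ (fun w => f (sliceMap I w)) w 1 := by
      rw [← mul_assoc, sub_mul, one_mul, mul_assoc J, hI', mul_neg_one, sub_neg_eq_add]
    have e2 : (1 + J * I) * (I * fderiv ℝ (fun w => f (sliceMap (-I) w)) w 1) =
        (I - J) * fderiv ℝ (fun w => f (sliceMap (-I) w)) w 1 := by
      rw [← mul_assoc, add_mul, one_mul, mul_assoc J, hI', mul_neg_one, ← sub_eq_add_neg]
    rw [e1, e2]
    simp only [mul_sub, mul_add, sub_mul, add_mul, one_mul, ← mul_assoc, hJ', ← two_mul, mul_two,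
      neg_mul]
    noncomm_ring
  have hreal : ∀ t : ℝ, D t = 0 := by
    intro t
    simp only [hD, sliceMap_ofReal]
    noncomm_ring
  have hzero : D z = 0 := by
    refine eq_zero_of_sliceFunctional_eq_zero (J := J) fun c => ?_
    have han : AnalyticOnNhd ℂ (fun w => sliceFunctional J c (D w)) (sliceMap I ⁻¹' T) :=
      DifferentiableOn.analyticOnNhd (fun w hw => (differentiableAt_comp_of_fderiv_eq (hD' w hw).1
        (hD' w hw).2 (sliceFunctional_mul hJ c)).differentiableWithinAt) hΩ
    have hfreq : ∃ᶠ w in 𝓝[≠] (x : ℂ), sliceFunctional J c (D w) = 0 := by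
      have ht : Tendsto (fun t : ℝ => (t : ℂ)) (𝓝[≠] x) (𝓝[≠] (x : ℂ)) :=
        Complex.continuous_ofReal.continuousAt.continuousWithinAt.tendsto_nhdsWithin
          fun t ht => by simpa using ht
      exact ht.frequently (Eventually.of_forall fun t => by rw [hreal, map_zero]).frequently
    exact han.eqOn_zero_of_preconnected_of_frequently_eq_zero hpre
      (by rwa [mem_preimage, sliceMap_ofReal]) hfreq hz
  rw [sliceMap_conj]
  exact sub_eq_zero.mp hzero

theorem polynomial_representation (hI : I ^ 2 = -1) (hJ : J ^ 2 = -1) (a : ℕ → ℍ[ℝ]) (n : ℕ)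
    (z : ℂ) :
    2 * ∑ k ∈ Finset.range n, sliceMap J z ^ k * a k =
      (1 - J * I) * ∑ k ∈ Finset.range n, sliceMap I z ^ k * a k +
        (1 + J * I) * ∑ k ∈ Finset.range n, sliceMap I (conj z) ^ k * a k := by
  simp only [Finset.mul_sum, ← Finset.sum_add_distrib]
  refine Finset.sum_congr rfl fun k _ => ?_
  rw [← sliceMap_pow hJ, ← sliceMap_pow hI, ← sliceMap_pow hI, ← mul_assoc, ← mul_assoc,
    ← mul_assoc, ← add_mul, sliceMap_eq_representation hI, map_pow]

theorem sum_sliceMap_pow_mul (hI : I ^ 2 = -1) (p : Polynomial ℂ) {n : ℕ} (hn : p.natDegree < n)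
    (z : ℂ) :
    ∑ k ∈ Finset.range n, sliceMap I z ^ k * sliceMap I (p.coeff k) = sliceMap I (p.eval z) := by
  rw [p.eval_eq_sum_range' hn, sliceMap_sum]
  refine Finset.sum_congr rfl fun k _ => ?_
  rw [mul_comm, sliceMap_mul hI, sliceMap_pow hI]

theorem exists_real_mem_of_isPreconnected {T : Set ℍ[ℝ]} (hT : AxiallySymmetric T)
    (hI : I ^ 2 = -1) (hpre : IsPreconnected (sliceMap I ⁻¹' T))
    (hne : (sliceMap I ⁻¹' T).Nonempty) : ∃ x : ℝ, (x : ℍ[ℝ]) ∈ T := by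
  obtain ⟨z, hz⟩ := hne
  have hz' : conj z ∈ sliceMap I ⁻¹' T := (hT.sliceMap_conj_mem_iff hI z).mpr hz
  have hord := (hpre.image Complex.im Complex.continuous_im.continuousOn).ordConnected
  have h0 : (0 : ℝ) ∈ uIcc z.im (conj z).im := by
    rw [Complex.conj_im, mem_uIcc]
    rcases le_total z.im 0 with h | h
    · exact Or.inl ⟨h, by linarith⟩
    · exact Or.inr ⟨by linarith, h⟩
  obtain ⟨w, hw, hw0⟩ := hord.uIcc_subset (mem_image_of_mem _ hz) (mem_image_of_mem _ hz') h0
  refine ⟨w.re, ?_⟩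
  rwa [mem_preimage, sliceMap, hw0, zero_smul, add_zero] at hw

theorem image_sliceMap_preimage (T : Set ℍ[ℝ]) (I : ℍ[ℝ]) :
    sliceMap I '' (sliceMap I ⁻¹' T) = T ∩ slicePlane I := by
  rw [image_preimage_eq_inter_range, range_sliceMap]

theorem IsJordanRegionIn.exists_range_eq_frontier {T : Set ℍ[ℝ]} (hI : I ^ 2 = -1)
    (hT : IsJordanRegionIn I (T ∩ slicePlane I)) :
    ∃ γ : Circle → ℂ, Continuous γ ∧ Function.Injective γ ∧
      range γ = frontier (sliceMap I ⁻¹' T) := by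
  obtain ⟨-, -, -, γ, hγ, hinj, hr⟩ := hT
  let e : ℂ ≃ₜ slicePlane I := (isometry_sliceMap hI).isEmbedding.toHomeomorph.trans
    (Homeomorph.setCongr (range_sliceMap I))
  have he : ∀ z, (e z : ℍ[ℝ]) = sliceMap I z := fun z => rfl
  refine ⟨e.symm ∘ γ, e.symm.continuous.comp hγ, e.symm.injective.comp hinj, ?_⟩
  have hpre : e ⁻¹' (Subtype.val ⁻¹' (T ∩ slicePlane I)) = sliceMap I ⁻¹' T := by
    ext z
    rw [mem_preimage, mem_preimage, he, mem_preimage, mem_inter_iff, ← range_sliceMap]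
    simp
  rw [range_comp, e.symm.image_eq_preimage_symm, e.symm_symm, hr, e.preimage_frontier, hpre]

/-- Mergelyan's theorem on one slice, for slice regular functions. -/
theorem exists_polynomial_norm_sub_lt_on_slice {T : Set ℍ[ℝ]} (hTo : IsOpen T)
    (hTb : Bornology.IsBounded T) (hI : I ^ 2 = -1) (hne : (sliceMap I ⁻¹' T).Nonempty)
    (hT : IsJordanRegionIn I (T ∩ slicePlane I)) {f : ℍ[ℝ] → ℍ[ℝ]} (hf : SliceRegularOn f T)
    (hfc : ContinuousOn f (closure T)) (c : ℍ[ℝ]) {ε : ℝ} (hε : 0 < ε) :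
    ∃ p : Polynomial ℂ, ∀ z ∈ sliceMap I ⁻¹' T,
      ‖sliceFunctional I c (f (sliceMap I z)) - p.eval z‖ < ε := by
  have hΩ : IsOpen (sliceMap I ⁻¹' T) := hTo.preimage (continuous_sliceMap I)
  have hΩb : Bornology.IsBounded (sliceMap I ⁻¹' T) :=
    (isometry_sliceMap hI).antilipschitz.isBounded_preimage hTb
  obtain ⟨γ, hγ, hinj, hr⟩ := hT.exists_range_eq_frontier hI
  have hmaps : MapsTo (sliceMap I) (closure (sliceMap I ⁻¹' T)) (closure T) :=
    (mapsTo_preimage _ _).closure (continuous_sliceMap I)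
  obtain ⟨p, hp⟩ := exists_polynomial_norm_sub_lt
    (f := fun z => sliceFunctional I c (f (sliceMap I z))) hΩb.isCompact_closure
    (isPreconnected_compl_closure_of_frontier_eq_range hΩ hΩb hne hγ hinj hr) subset_closure
    (compl_subset_closure_compl_closure hΩ hΩb hγ hinj hr)
    ((sliceFunctional I c).continuous.comp_continuousOn
      (hfc.comp (continuous_sliceMap I).continuousOn hmaps))
    (fun z hz => (differentiableAt_comp_of_fderiv_eq (hf.comp_sliceMap hTo hI hz).1
      (hf.comp_sliceMap hTo hI hz).2 (sliceFunctional_mul hI c)).differentiableWithinAt) hε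
  exact ⟨p, fun z hz => hp z (subset_closure hz)⟩

theorem exists_sliceMap_sliceFunctional_add_eq : ∃ I j : ℍ[ℝ], I ^ 2 = -1 ∧ ‖j‖ = 1 ∧
    ∀ q, sliceMap I (sliceFunctional I 1 q) + sliceMap I (sliceFunctional I (-j) q) * j = q := by
  obtain ⟨I, h0, h1, h2, h3⟩ : ∃ I : ℍ[ℝ], I.re = 0 ∧ I.imI = 1 ∧ I.imJ = 0 ∧ I.imK = 0 :=
    ⟨⟨0, 1, 0, 0⟩, rfl, rfl, rfl, rfl⟩
  obtain ⟨j, j0, j1, j2, j3⟩ : ∃ j : ℍ[ℝ], j.re = 0 ∧ j.imI = 0 ∧ j.imJ = 1 ∧ j.imK = 0 :=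
    ⟨⟨0, 0, 1, 0⟩, rfl, rfl, rfl, rfl⟩
  refine ⟨I, j, ?_, (normSq_sliceUnit ?_).2, fun q => ?_⟩
  · rw [sq]
    apply Quaternion.ext <;> simp [h0, h1, h2, h3]
  · rw [sq]
    apply Quaternion.ext <;> simp [j0, j1, j2, j3]
  · simp only [sliceFunctional_apply, sliceMap]
    apply Quaternion.ext <;> simp [h0, h1, h2, h3, j0, j1, j2, j3]

end Representation

/-- **Mergelyan-type approximation on sets of class `𝔯(ℍ)`.** Let `T ∈ 𝔯(ℍ)` be bounded
with every slice `T ∩ ℂ_I` a Jordan region in `ℂ_I`. If `f` is slice regular on `T` and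
continuous on `closure T`, then for every `ε > 0` there is a polynomial
`P(q) = ∑_{k=0}^n q^k a_k` with `sup_{q ∈ closure T} ‖f q − P q‖ < ε`. -/
theorem mergelyan_type_frakR
    (T : Set (Quaternion ℝ)) (hT : MemFrakR T) (hTbdd : Bornology.IsBounded T)
    (hTslice : ∀ I : Quaternion ℝ, I ^ 2 = -1 → IsJordanRegionIn I (T ∩ slicePlane I))
    (f : Quaternion ℝ → Quaternion ℝ)
    (hfreg : SliceRegularOn f T) (hfcont : ContinuousOn f (closure T))
    (ε : ℝ) (hε : 0 < ε) :
    ∃ (n : ℕ) (a : ℕ → Quaternion ℝ), ∀ q ∈ closure T,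
      ‖f q - ∑ k ∈ Finset.range (n + 1), q ^ k * a k‖ < ε := by
  obtain ⟨hTo, hTs, hTc⟩ := hT
  obtain ⟨I, j, hI, hj, hIj⟩ := exists_sliceMap_sliceFunctional_add_eq
  have hsc := hTc I hI
  have hpc : IsConnected (sliceMap I '' (sliceMap I ⁻¹' T)) := by
    rw [image_sliceMap_preimage, isConnected_iff_connectedSpace]
    infer_instance
  have hne : (sliceMap I ⁻¹' T).Nonempty := hpc.nonempty.of_image
  have hpre : IsPreconnected (sliceMap I ⁻¹' T) :=
    (isometry_sliceMap hI).isEmbedding.isInducing.isPreconnected_image.mp hpc.isPreconnected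
  obtain ⟨x, hx⟩ := exists_real_mem_of_isPreconnected hTs hI hpre hne
  obtain ⟨p, hp⟩ := exists_polynomial_norm_sub_lt_on_slice hTo hTbdd hI hne (hTslice I hI) hfreg
    hfcont 1 (show 0 < ε / 8 by positivity)
  obtain ⟨r, hr⟩ := exists_polynomial_norm_sub_lt_on_slice hTo hTbdd hI hne (hTslice I hI) hfreg
    hfcont (-j) (show 0 < ε / 8 by positivity)
  set n := max p.natDegree r.natDegree
  set a : ℕ → Quaternion ℝ := fun k => sliceMap I (p.coeff k) + sliceMap I (r.coeff k) * j with ha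
  refine ⟨n, a, ?_⟩
  have hslice : ∀ z ∈ sliceMap I ⁻¹' T, ‖f (sliceMap I z) -
      ∑ k ∈ Finset.range (n + 1), sliceMap I z ^ k * a k‖ ≤ ε / 4 := by
    intro z hz
    have hsum : ∑ k ∈ Finset.range (n + 1), sliceMap I z ^ k * a k =
        sliceMap I (p.eval z) + sliceMap I (r.eval z) * j := by
      rw [← sum_sliceMap_pow_mul hI p (Nat.lt_succ_of_le (le_max_left _ r.natDegree)),
        ← sum_sliceMap_pow_mul hI r (Nat.lt_succ_of_le (le_max_right p.natDegree _)),
        Finset.sum_mul, ← Finset.sum_add_distrib]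
      exact Finset.sum_congr rfl fun k _ => by rw [ha, mul_add, mul_assoc]
    rw [hsum, ← hIj (f (sliceMap I z)), add_sub_add_comm, ← sub_mul,
      ← sliceMap_sub, ← sliceMap_sub]
    refine (norm_add_le _ _).trans ?_
    rw [norm_mul, hj, mul_one, norm_sliceMap hI, norm_sliceMap hI]
    linarith [hp z hz, hr z hz]
  have hT' : ∀ q ∈ T, ‖f q - ∑ k ∈ Finset.range (n + 1), q ^ k * a k‖ ≤ ε / 2 := by
    intro q hq
    obtain ⟨J, z, hJ, rfl⟩ := exists_sliceMap_eq hI q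
    have hz : sliceMap I z ∈ T := (hTs.sliceMap_mem_iff hI hJ z).mp hq
    have hz' : sliceMap I (starRingEnd ℂ z) ∈ T := (hTs.sliceMap_conj_mem_iff hI z).mpr hz
    have hkey : 2 * (f (sliceMap J z) - ∑ k ∈ Finset.range (n + 1), sliceMap J z ^ k * a k) =
        (1 - J * I) * (f (sliceMap I z) - ∑ k ∈ Finset.range (n + 1), sliceMap I z ^ k * a k) +
        (1 + J * I) * (f (sliceMap I (starRingEnd ℂ z)) -
          ∑ k ∈ Finset.range (n + 1), sliceMap I (starRingEnd ℂ z) ^ k * a k) := by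
      rw [mul_sub, mul_sub, mul_sub, hfreg.representation hTo hTs hI hJ hpre hx hz,
        polynomial_representation hI hJ, add_sub_add_comm]
    have h2 := norm_add_le
      ((1 - J * I) * (f (sliceMap I z) - ∑ k ∈ Finset.range (n + 1), sliceMap I z ^ k * a k))
      ((1 + J * I) * (f (sliceMap I (starRingEnd ℂ z)) -
          ∑ k ∈ Finset.range (n + 1), sliceMap I (starRingEnd ℂ z) ^ k * a k))
    have hn2 : ‖(2 : Quaternion ℝ)‖ = 2 := by
      rw [← map_ofNat (algebraMap ℝ (Quaternion ℝ)) 2, norm_algebraMap', Real.norm_ofNat]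
    have hs : ‖1 - J * I‖ ≤ 2 := by
      rw [sub_eq_add_neg, ← neg_mul]
      exact norm_one_add_mul_le hI (by rw [neg_sq, hJ])
    rw [← hkey, norm_mul, norm_mul, norm_mul, hn2] at h2
    have h3 := mul_le_mul hs (hslice z hz) (norm_nonneg _) zero_le_two
    have h4 := mul_le_mul (norm_one_add_mul_le hI hJ) (hslice _ hz') (norm_nonneg _) zero_le_two
    linarith
  intro q hq
  have hcont : ContinuousOn (fun q => ‖f q - ∑ k ∈ Finset.range (n + 1), q ^ k * a k‖)
      (closure T) := by
    refine (hfcont.sub (Continuous.continuousOn ?_)).norm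
    fun_prop
  have hle := le_on_closure hT' hcont continuousOn_const hq
  exact hle.trans_lt (by linarith)
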